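/- arXiv:1609.00215 — 2 statements merged into one kernel-verified Lean document; each statement's English description precedes it below -/
import Mathlib

section
/- Theorem 4.8 (ii): A subset K ⊆ D([0,T]) is relatively mJ1-compact (i.e. its closure in (D([0,T]), d) is compact) if and only if K is uniformly bounded, sup_{x ∈ K} sup_{t ∈ [0,T]} |x(t)| < +∞, and lim_{δ → 0} sup_{x ∈ K} sup { min(|x(t) − x(s)|, |x(u) − x(t)|) : 0− ≤ s < t < u ≤ T, u − s < δ } = 0, where the symbol 0− is allowed as a value of s, with the conventions x(0−) = 0 and u − (0−) = u; equivalently the second condition reads: lim_{δ→0} sup_{x∈K} max( sup{ min(|x(t) − x(s)|, |x(u) − x(t)|) : 0 ≤ s < t < u ≤ T, u − s < δ }, sup{ min(|x(t)|, |x(u) − x(t)|) : 0 ≤ t < u ≤ T, u < δ } ) = 0. -/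
open MeasureTheory Filter Set Topology

noncomputable section

/-- `x` is càdlàg on `[0,T]`: right-continuous at every `t ∈ [0,T)` and
admitting a left limit at every `t ∈ (0,T]`. -/
def Cadlag (T : ℝ) (x : ℝ → ℝ) : Prop :=
  (∀ t ∈ Set.Ico (0:ℝ) T, Filter.Tendsto x (nhdsWithin t (Set.Ioi t)) (nhds (x t))) ∧
  (∀ t ∈ Set.Ioc (0:ℝ) T, ∃ L : ℝ, Filter.Tendsto x (nhdsWithin t (Set.Iio t)) (nhds L))

/-- membership in `𝕍`: càdlàg of finite total variation on `[0,T]`. -/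
def MemV (T : ℝ) (v : ℝ → ℝ) : Prop :=
  Cadlag T v ∧ BoundedVariationOn v (Set.Icc 0 T)

/-- `μ` is the finite signed (Lebesgue–Stieltjes) measure induced by `v` on `[0,T]`:
`μ([0,t]) = v(t)` for `t ∈ [0,T]`, and `μ` vanishes outside `[0,T]`. -/
def Represents (T : ℝ) (μ : MeasureTheory.SignedMeasure ℝ) (v : ℝ → ℝ) : Prop :=
  (∀ t ∈ Set.Icc (0:ℝ) T, μ (Set.Icc 0 t) = v t) ∧
  (∀ s : Set ℝ, MeasurableSet s → s ∩ Set.Icc (0:ℝ) T = ∅ → μ s = 0)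

/-- Integral of `f` against a signed measure. -/
noncomputable def sInt (μ : MeasureTheory.SignedMeasure ℝ) (f : ℝ → ℝ) : ℝ :=
  (∫ t, f t ∂μ.toJordanDecomposition.posPart) - (∫ t, f t ∂μ.toJordanDecomposition.negPart)

/-- `∫_{[0,T]} f dv` : integral of `f` with respect to the Lebesgue–Stieltjes
signed measure induced by `v` on `[0,T]`. -/
noncomputable def intD (T : ℝ) (f v : ℝ → ℝ) : ℝ :=
  letI := Classical.propDecidable (∃ μ : MeasureTheory.SignedMeasure ℝ, Represents T μ v)
  if h : ∃ μ : MeasureTheory.SignedMeasure ℝ, Represents T μ v then sInt h.choose f else 0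

/-- S-convergence `x_n →_S x₀` on `D([0,T])`. -/
def SConv (T : ℝ) (x : ℕ → ℝ → ℝ) (x₀ : ℝ → ℝ) : Prop :=
  ∀ ε > (0:ℝ), ∃ v : ℕ → ℝ → ℝ, ∃ v₀ : ℝ → ℝ,
    (∀ n, MemV T (v n)) ∧ MemV T v₀ ∧
    (∀ n, ∀ t ∈ Set.Icc (0:ℝ) T, |x n t - v n t| ≤ ε) ∧
    (∀ t ∈ Set.Icc (0:ℝ) T, |x₀ t - v₀ t| ≤ ε) ∧
    (∀ f : ℝ → ℝ, Continuous f →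
      Filter.Tendsto (fun n => intD T f (v n)) Filter.atTop (nhds (intD T f v₀)))

/-- `x_n ⇒*_S x₀` : every subsequence contains a further subsequence `→_S`-converging to `x₀`. -/
def SStarConv (T : ℝ) (x : ℕ → ℝ → ℝ) (x₀ : ℝ → ℝ) : Prop :=
  ∀ φ : ℕ → ℕ, StrictMono φ →
    ∃ ψ : ℕ → ℕ, StrictMono ψ ∧ SConv T (fun k => x (φ (ψ k))) x₀

/-- membership in `𝔸([0,T])`: continuous, of finite variation, vanishing at `0`. -/
def MemA (T : ℝ) (A : ℝ → ℝ) : Prop :=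
  ContinuousOn A (Set.Icc 0 T) ∧ BoundedVariationOn A (Set.Icc 0 T) ∧ A 0 = 0

/-- `A_n →_τ A₀` : uniform convergence on `[0,T]` together with uniformly bounded
total variations. -/
def TauConv (T : ℝ) (A : ℕ → ℝ → ℝ) (A₀ : ℝ → ℝ) : Prop :=
  TendstoUniformlyOn (fun n => A n) A₀ Filter.atTop (Set.Icc 0 T) ∧
  ∃ M : ℝ, ∀ n, eVariationOn (A n) (Set.Icc 0 T) ≤ ENNReal.ofReal M

/-- `x` has (at least) `k` up-crossings of the levels `a < b` on `[0,T]`. -/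
def HasUpcrossings (T a b : ℝ) (x : ℝ → ℝ) (k : ℕ) : Prop :=
  ∃ s u : Fin k → ℝ, (∀ i, 0 ≤ s i ∧ s i < u i ∧ u i ≤ T) ∧
    (∀ i j : Fin k, i < j → u i < s j) ∧
    (∀ i, x (s i) < a ∧ b < x (u i))

/-- `x` has (at least) `k` `η`-oscillations on `[0,T]`. -/
def HasOscillations (T η : ℝ) (x : ℝ → ℝ) (k : ℕ) : Prop :=
  ∃ s u : Fin k → ℝ, (∀ i, 0 ≤ s i ∧ s i < u i ∧ u i ≤ T) ∧
    (∀ i j : Fin k, i < j → u i ≤ s j) ∧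
    (∀ i, |x (u i) - x (s i)| > η)


/-- extension of `x ∈ D([0,T])` to a function which is `0` before `0` and
constantly `x T` after `T`. -/
def extFn (T : ℝ) (x : ℝ → ℝ) : ℝ → ℝ := fun t =>
  if t < 0 then 0 else if t < T then x t else x T

/-- `l` is an admissible time change of `[a,b]`: a strictly increasing continuous
bijection of `[a,b]` onto itself. -/
def TimeChange (a b : ℝ) (l : ℝ → ℝ) : Prop :=
  ContinuousOn l (Set.Icc a b) ∧ StrictMonoOn l (Set.Icc a b) ∧
    l a = a ∧ l b = b ∧ Set.MapsTo l (Set.Icc a b) (Set.Icc a b)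

/-- Billingsley's complete metric for the `J₁` topology on `D([a,b])`:
`d_Sk(x,y)` is the infimum, over time changes `l` of `[a,b]`, of the maximum of
`sup_{s<t} |log((l t - l s)/(t - s))|` and `sup_t |x t - y (l t)|`. -/
noncomputable def dSk (a b : ℝ) (x y : ℝ → ℝ) : ℝ :=
  sInf {r : ℝ | 0 ≤ r ∧ ∃ l : ℝ → ℝ, TimeChange a b l ∧
    (∀ s ∈ Set.Icc a b, ∀ t ∈ Set.Icc a b, s < t →
      |Real.log ((l t - l s) / (t - s))| ≤ r) ∧
    (∀ t ∈ Set.Icc a b, |x t - y (l t)| ≤ r)}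

/-- the metric of the `mJ₁` topology on `D([0,T])` (with parameter `ε > 0`). -/
noncomputable def dmJ (T ε : ℝ) (x y : ℝ → ℝ) : ℝ :=
  dSk (-ε) (T + ε) (extFn T x) (extFn T y)

theorem extFn_of_mem {T t : ℝ} (x : ℝ → ℝ) (ht : t ∈ Icc 0 T) : extFn T x t = x t := by
  unfold extFn
  rw [if_neg (not_lt.2 ht.1)]
  split_ifs with h
  · rfl
  · rw [le_antisymm ht.2 (not_lt.1 h)]

theorem extFn_of_neg {T t : ℝ} (x : ℝ → ℝ) (ht : t < 0) : extFn T x t = 0 := if_pos ht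

theorem extFn_of_ge {T t : ℝ} (hT : 0 ≤ T) (x : ℝ → ℝ) (ht : T ≤ t) : extFn T x t = x T := by
  unfold extFn
  rw [if_neg (not_lt.2 (hT.trans ht)), if_neg (not_lt.2 ht)]

theorem Cadlag.tendsto_extFn_right {T : ℝ} (hT : 0 < T) {x : ℝ → ℝ} (hx : Cadlag T x) (t : ℝ) :
    Tendsto (extFn T x) (𝓝[>] t) (𝓝 (extFn T x t)) := by
  rcases lt_or_ge t 0 with h | h
  · rw [extFn_of_neg x h]
    refine tendsto_const_nhds.congr' ?_
    filter_upwards [Ioo_mem_nhdsGT h] with u hu using (extFn_of_neg x hu.2).symm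
  rcases lt_or_ge t T with h' | h'
  · rw [extFn_of_mem x ⟨h, h'.le⟩]
    refine (hx.1 t ⟨h, h'⟩).congr' ?_
    filter_upwards [Ioo_mem_nhdsGT h'] with u hu
    exact (extFn_of_mem x ⟨h.trans hu.1.le, hu.2.le⟩).symm
  · rw [extFn_of_ge hT.le x h']
    refine tendsto_const_nhds.congr' ?_
    filter_upwards [self_mem_nhdsWithin] with u hu
    exact (extFn_of_ge hT.le x (h'.trans (le_of_lt hu))).symm

theorem Cadlag.tendsto_extFn_left {T : ℝ} (hT : 0 < T) {x : ℝ → ℝ} (hx : Cadlag T x) (t : ℝ) :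
    ∃ L, Tendsto (extFn T x) (𝓝[<] t) (𝓝 L) := by
  rcases le_or_gt t 0 with h | h
  · refine ⟨0, tendsto_const_nhds.congr' ?_⟩
    filter_upwards [self_mem_nhdsWithin] with u hu
    exact (extFn_of_neg x (lt_of_lt_of_le hu h)).symm
  rcases le_or_gt t T with h' | h'
  · obtain ⟨L, hL⟩ := hx.2 t ⟨h, h'⟩
    refine ⟨L, hL.congr' ?_⟩
    filter_upwards [Ioo_mem_nhdsLT h] with u hu
    exact (extFn_of_mem x ⟨hu.1.le, hu.2.le.trans h'⟩).symm
  · refine ⟨x T, tendsto_const_nhds.congr' ?_⟩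
    filter_upwards [Ioo_mem_nhdsLT h'] with u hu
    exact (extFn_of_ge hT.le x hu.1.le).symm

/-- A function with one-sided limits, right-continuous at `c`, oscillates little on each side
of `c`. -/
theorem exists_small_oscillation {X : ℝ → ℝ} {c L η : ℝ} (hη : 0 < η)
    (hr : Tendsto X (𝓝[>] c) (𝓝 (X c))) (hl : Tendsto X (𝓝[<] c) (𝓝 L)) :
    ∃ ρ > 0, (∀ t ∈ Ioo (c - ρ) c, |X t - L| < η) ∧ ∀ t ∈ Ico c (c + ρ), |X t - X c| < η := by
  obtain ⟨u, hu, hu'⟩ := mem_nhdsGT_iff_exists_Ioo_subset.1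
    (hr (Metric.ball_mem_nhds _ hη))
  obtain ⟨s, hs, hs'⟩ := mem_nhdsLT_iff_exists_Ioo_subset.1
    (hl (Metric.ball_mem_nhds _ hη))
  rw [mem_Ioi] at hu
  rw [mem_Iio] at hs
  refine ⟨min (u - c) (c - s), lt_min (by linarith) (by linarith), fun t ht => ?_, fun t ht => ?_⟩
  · have := min_le_right (u - c) (c - s)
    exact hs' ⟨by linarith [ht.1], ht.2⟩
  · rcases ht.1.eq_or_lt with h | h
    · simpa [← h] using hη
    · have := min_le_left (u - c) (c - s)
      exact hu' ⟨h, by linarith [ht.2]⟩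

theorem exists_bound_of_one_sided_limits {X : ℝ → ℝ}
    (hr : ∀ c, Tendsto X (𝓝[>] c) (𝓝 (X c))) (hl : ∀ c, ∃ L, Tendsto X (𝓝[<] c) (𝓝 L))
    (a b : ℝ) : ∃ M, ∀ t ∈ Icc a b, |X t| ≤ M := by
  refine (isCompact_Icc (a := a) (b := b)).induction_on (p := fun S => ∃ M, ∀ t ∈ S, |X t| ≤ M)
    ⟨0, by simp⟩ (fun s t hst ⟨M, hM⟩ => ⟨M, fun u hu => hM u (hst hu)⟩) ?_ ?_
  · rintro s t ⟨M, hM⟩ ⟨M', hM'⟩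
    refine ⟨max M M', fun u hu => ?_⟩
    rcases hu with hu | hu
    · exact (hM u hu).trans (le_max_left _ _)
    · exact (hM' u hu).trans (le_max_right _ _)
  · intro c _
    obtain ⟨L, hL⟩ := hl c
    obtain ⟨ρ, hρ, h1, h2⟩ := exists_small_oscillation one_pos (hr c) hL
    refine ⟨Ioo (c - ρ) (c + ρ),
      mem_nhdsWithin_of_mem_nhds (Ioo_mem_nhds (by linarith) (by linarith)),
      max (|L| + 1) (|X c| + 1), fun t ht => ?_⟩
    rcases lt_or_ge t c with h | h
    · refine le_max_of_le_left ?_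
      have := h1 t ⟨ht.1, h⟩
      linarith [abs_sub_abs_le_abs_sub (X t) L]
    · refine le_max_of_le_right ?_
      have := h2 t ⟨h, ht.2⟩
      linarith [abs_sub_abs_le_abs_sub (X t) (X c)]

theorem exists_modulus_of_one_sided_limits {X : ℝ → ℝ}
    (hr : ∀ c, Tendsto X (𝓝[>] c) (𝓝 (X c))) (hl : ∀ c, ∃ L, Tendsto X (𝓝[<] c) (𝓝 L))
    (a b : ℝ) {η : ℝ} (hη : 0 < η) :
    ∃ δ > 0, ∀ s t u, t ∈ Icc a b → s < t → t < u → u - s < δ →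
      min |X t - X s| |X u - X t| ≤ η := by
  choose L hL using hl
  choose ρ hρ h1 h2 using fun c => exists_small_oscillation (half_pos hη) (hr c) (hL c)
  obtain ⟨δ, hδ, H⟩ := lebesgue_number_lemma_of_metric (isCompact_Icc (a := a) (b := b))
    (c := fun c => Metric.ball c (ρ c)) (fun c => Metric.isOpen_ball)
    (fun t _ => mem_iUnion.2 ⟨t, Metric.mem_ball_self (hρ t)⟩)
  refine ⟨δ, hδ, fun s t u ht hst htu hus => ?_⟩
  obtain ⟨c, hc⟩ := H t ht
  rw [Real.ball_eq_Ioo, Real.ball_eq_Ioo] at hc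
  have hs := hc (show s ∈ Ioo (t - δ) (t + δ) from ⟨by linarith, by linarith⟩)
  have hu := hc (show u ∈ Ioo (t - δ) (t + δ) from ⟨by linarith, by linarith⟩)
  rcases lt_or_ge t c with h | h
  · refine min_le_of_left_le ?_
    have e1 := h1 c s ⟨hs.1, hst.trans h⟩
    have e2 := h1 c t ⟨hs.1.trans hst, h⟩
    rw [abs_lt] at e1 e2
    rw [abs_le]
    constructor <;> linarith
  · refine min_le_of_right_le ?_
    have e1 := h2 c t ⟨h, htu.trans hu.2⟩
    have e2 := h2 c u ⟨h.trans htu.le, hu.2⟩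
    rw [abs_lt] at e1 e2
    rw [abs_le]
    constructor <;> linarith

theorem exists_timeChange_of_dSk_lt {a b r : ℝ} (hab : a ≤ b) {x y : ℝ → ℝ}
    (hx : ∃ M, ∀ t ∈ Icc a b, |x t| ≤ M) (hy : ∃ M, ∀ t ∈ Icc a b, |y t| ≤ M)
    (h : dSk a b x y < r) :
    ∃ l, TimeChange a b l ∧
      (∀ s ∈ Icc a b, ∀ t ∈ Icc a b, s < t → l t - l s ≤ Real.exp r * (t - s)) ∧
      ∀ t ∈ Icc a b, |x t - y (l t)| ≤ r := by
  obtain ⟨M, hM⟩ := hx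
  obtain ⟨M', hM'⟩ := hy
  have hM0 := (abs_nonneg _).trans (hM a ⟨le_rfl, hab⟩)
  have hM0' := (abs_nonneg _).trans (hM' a ⟨le_rfl, hab⟩)
  obtain ⟨r', ⟨-, l, hl, hlog, hd⟩, hr'⟩ := exists_lt_of_csInf_lt (by
    exact ⟨M + M', by positivity, id, ⟨continuousOn_id, strictMonoOn_id, rfl, rfl, mapsTo_id _⟩,
      fun s _ t _ hst => by
        have : t - s ≠ 0 := by linarith
        simpa [div_self this] using add_nonneg hM0 hM0',
      fun t ht => (abs_sub _ _).trans (add_le_add (hM t ht) (hM' t ht))⟩) h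
  refine ⟨l, hl, fun s hs t ht hst => ?_, fun t ht => (hd t ht).trans hr'.le⟩
  have h1 := (le_abs_self _).trans ((hlog s hs t ht hst).trans hr'.le)
  have h2 : 0 < l t - l s := sub_pos.2 (hl.2.1 hs ht hst)
  have h3 : 0 < t - s := sub_pos.2 hst
  rwa [Real.log_le_iff_le_exp (div_pos h2 h3), div_le_iff₀ h3] at h1

theorem min_abs_sub_le_of_timeChange {a b r δ η : ℝ} (hr : r ≤ 1) {X Y l : ℝ → ℝ}
    (hl : TimeChange a b l)
    (hlip : ∀ s ∈ Icc a b, ∀ t ∈ Icc a b, s < t → l t - l s ≤ Real.exp r * (t - s))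
    (hXY : ∀ t ∈ Icc a b, |X t - Y (l t)| ≤ r)
    (hY : ∀ s t u, t ∈ Icc a b → s < t → t < u → u - s < δ → min |Y t - Y s| |Y u - Y t| ≤ η)
    {s t u : ℝ} (hs : s ∈ Icc a b) (hu : u ∈ Icc a b) (hst : s < t) (htu : t < u)
    (hus : u - s < δ / Real.exp 1) : min |X t - X s| |X u - X t| ≤ η + 2 * r := by
  have ht : t ∈ Icc a b := ⟨hs.1.trans hst.le, htu.le.trans hu.2⟩
  have hlt : l u - l s < δ := by
    have h1 := hlip s hs u hu (hst.trans htu)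
    have h2 : Real.exp r * (u - s) ≤ Real.exp 1 * (u - s) := by
      have := Real.exp_le_exp.2 hr
      have : 0 < u - s := by linarith
      gcongr
    rw [lt_div_iff₀ (Real.exp_pos 1)] at hus
    linarith
  have e1 := abs_le.1 (hXY s hs)
  have e2 := abs_le.1 (hXY t ht)
  have e3 := abs_le.1 (hXY u hu)
  rcases min_le_iff.1 (hY _ _ _ (hl.2.2.2.2 ht) (hl.2.1 hs ht hst) (hl.2.1 ht hu htu) hlt)
    with h | h
  · refine min_le_of_left_le ?_
    rw [abs_le] at h ⊢
    constructor <;> linarith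
  · refine min_le_of_right_le ?_
    rw [abs_le] at h ⊢
    constructor <;> linarith

theorem exists_timeChange_of_tendsto_dmJ {T ε : ℝ} (hT : 0 < T) (hε : 0 < ε) {x : ℕ → ℝ → ℝ}
    {y : ℝ → ℝ} (hx : ∀ n, Cadlag T (x n)) (hy : Cadlag T y)
    (h : Tendsto (fun n => dmJ T ε (x n) y) atTop (𝓝 0)) {r : ℝ} (hr : 0 < r) :
    ∀ᶠ n in atTop, ∃ l, TimeChange (-ε) (T + ε) l ∧
      (∀ s ∈ Icc (-ε) (T + ε), ∀ t ∈ Icc (-ε) (T + ε), s < t →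
        l t - l s ≤ Real.exp r * (t - s)) ∧
      ∀ t ∈ Icc (-ε) (T + ε), |extFn T (x n) t - extFn T y (l t)| ≤ r := by
  filter_upwards [h.eventually_lt_const hr] with n hn
  exact exists_timeChange_of_dSk_lt (by linarith)
    (exists_bound_of_one_sided_limits (fun c => (hx n).tendsto_extFn_right hT c)
      (fun c => (hx n).tendsto_extFn_left hT c) _ _)
    (exists_bound_of_one_sided_limits (fun c => hy.tendsto_extFn_right hT c)
      (fun c => hy.tendsto_extFn_left hT c) _ _) hn

/-- Sequential relative compactness for `dmJ` of a set of càdlàg functions. -/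
def RelSeqCompact (T ε : ℝ) (K : Set (ℝ → ℝ)) : Prop :=
  ∀ x : ℕ → ℝ → ℝ, (∀ n, x n ∈ K) →
    ∃ φ : ℕ → ℕ, StrictMono φ ∧ ∃ x₀ : ℝ → ℝ, Cadlag T x₀ ∧
      Tendsto (fun k => dmJ T ε (x (φ k)) x₀) atTop (𝓝 0)

theorem RelSeqCompact.uniformly_bounded {T ε : ℝ} (hT : 0 < T) (hε : 0 < ε) {K : Set (ℝ → ℝ)}
    (hK : ∀ x ∈ K, Cadlag T x) (h : RelSeqCompact T ε K) :
    ∃ M : ℝ, ∀ x ∈ K, ∀ t ∈ Icc (0 : ℝ) T, |x t| ≤ M := by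
  by_contra! hcon
  choose x hxK t ht hlt using fun n : ℕ => hcon n
  obtain ⟨φ, hφ, y, hy, hlim⟩ := h x hxK
  obtain ⟨M, hM⟩ := exists_bound_of_one_sided_limits (fun c => hy.tendsto_extFn_right hT c)
    (fun c => hy.tendsto_extFn_left hT c) (-ε) (T + ε)
  obtain ⟨n, ⟨l, hl, -, hd⟩, hn⟩ := ((exists_timeChange_of_tendsto_dmJ hT hε
    (fun n => hK _ (hxK (φ n))) hy hlim one_pos).and
      (eventually_ge_atTop ⌈M + 1⌉₊)).exists
  have htn := ht (φ n)
  have hmem : t (φ n) ∈ Icc (-ε) (T + ε) := ⟨by linarith [htn.1], by linarith [htn.2]⟩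
  have h1 := hd _ hmem
  rw [extFn_of_mem _ htn] at h1
  have h2 := hM _ (hl.2.2.2.2 hmem)
  have h3 := hlt (φ n)
  have h4 : (n : ℝ) ≤ φ n := by exact_mod_cast hφ.id_le n
  have h5 := Nat.ceil_le.1 hn
  have := abs_sub_abs_le_abs_sub (x (φ n) (t (φ n))) (extFn T y (l (t (φ n))))
  linarith

theorem RelSeqCompact.equi_modulus {T ε : ℝ} (hT : 0 < T) (hε : 0 < ε) {K : Set (ℝ → ℝ)}
    (hK : ∀ x ∈ K, Cadlag T x) (h : RelSeqCompact T ε K) {η : ℝ} (hη : 0 < η) :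
    ∃ δ > 0, ∀ x ∈ K, ∀ s t u : ℝ, s ∈ Icc (-ε) T → s < t → t < u → u ≤ T → u - s < δ →
      min |extFn T x t - extFn T x s| |extFn T x u - extFn T x t| ≤ η := by
  by_contra! hcon
  choose x hxK s t u hs hst htu huT hus hlt using
    fun n : ℕ => hcon (1 / ((n : ℝ) + 1)) Nat.one_div_pos_of_nat
  obtain ⟨φ, hφ, y, hy, hlim⟩ := h x hxK
  obtain ⟨δ, hδ, hmod⟩ := exists_modulus_of_one_sided_limits
    (fun c => hy.tendsto_extFn_right hT c) (fun c => hy.tendsto_extFn_left hT c)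
    (-ε) (T + ε) (half_pos hη)
  have hsmall : ∀ᶠ n : ℕ in atTop, 1 / ((φ n : ℝ) + 1) < δ / Real.exp 1 :=
    (tendsto_one_div_add_atTop_nhds_zero_nat.comp hφ.tendsto_atTop).eventually_lt_const
      (div_pos hδ (Real.exp_pos 1))
  obtain ⟨n, ⟨l, hl, hlip, hd⟩, hn⟩ := ((exists_timeChange_of_tendsto_dmJ hT hε
    (fun n => hK _ (hxK (φ n))) hy hlim
      (lt_min one_pos (by positivity : 0 < η / 4))).and hsmall).exists
  have := min_abs_sub_le_of_timeChange (min_le_left _ _) hl hlip hd hmod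
    (s := s (φ n)) (t := t (φ n)) (u := u (φ n))
    ⟨(hs _).1, by linarith [(hs (φ n)).2]⟩
    ⟨by linarith [(hs (φ n)).1, hst (φ n), htu (φ n)], by linarith [huT (φ n)]⟩
    (hst _) (htu _) ((hus _).trans hn)
  linarith [hlt (φ n), min_le_right 1 (η / 4)]

/-- First exit time of a right-continuous function from a closed ball around its value at `p`. -/
theorem exists_first_exit {X : ℝ → ℝ} (hr : ∀ c, Tendsto X (𝓝[>] c) (𝓝 (X c))) {p θ : ℝ}
    (hθ : 0 < θ) (h : ∃ t, p < t ∧ θ < |X t - X p|) :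
    ∃ q, p < q ∧ (∀ t ∈ Ico p q, |X t - X p| ≤ θ) ∧ θ ≤ |X q - X p| ∧
      ∀ t, p < t → θ < |X t - X p| → q ≤ t := by
  set S := {t | p < t ∧ θ < |X t - X p|} with hS
  have hne : S.Nonempty := h
  have hbdd : BddBelow S := ⟨p, fun t ht => ht.1.le⟩
  have hpq : p ≤ sInf S := le_csInf hne fun t ht => ht.1.le
  have hge : θ ≤ |X (sInf S) - X p| := by
    by_contra! hcon
    have h1 : ∀ᶠ t in 𝓝[>] (sInf S), |X t - X p| < θ :=
      (((hr (sInf S)).sub_const (X p)).abs).eventually_lt_const hcon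
    obtain ⟨v, hv, hv'⟩ := mem_nhdsGT_iff_exists_Ioo_subset.1 h1
    obtain ⟨t, ht, htv⟩ := exists_lt_of_csInf_lt hne hv
    rcases (csInf_le hbdd ht).eq_or_lt with h2 | h2
    · rw [h2] at hcon
      exact lt_asymm hcon ht.2
    · exact lt_asymm (hv' ⟨h2, htv⟩ : |X t - X p| < θ) ht.2
  refine ⟨sInf S, hpq.lt_of_ne fun h0 => ?_, fun t ht => ?_, hge,
    fun t h1 h2 => csInf_le hbdd ⟨h1, h2⟩⟩
  · rw [← h0, sub_self, abs_zero] at hge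
    exact absurd hθ (not_lt.2 hge)
  · rcases ht.1.eq_or_lt with h0 | h0
    · simpa [← h0] using hθ.le
    · by_contra! h1
      exact absurd (csInf_le hbdd ⟨h0, h1⟩) (not_le.2 ht.2)

/-- Inductive step in the construction of a partition with well separated points on whose cells
`X` oscillates little: `p` is a time after which `X` is steady for at least `δ / 2`. -/
theorem exists_next_time {X : ℝ → ℝ} (hr : ∀ c, Tendsto X (𝓝[>] c) (𝓝 (X c))) {T δ η : ℝ}
    (hη : 0 < η) (hδ : 0 < δ) (hT : ∀ t, T ≤ t → X t = X T)
    (hw : ∀ s t u, s < t → t < u → u - s < δ → min |X t - X s| |X u - X t| ≤ η)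
    {p : ℝ} (hp : p ≤ T) (hgood : ∀ t ∈ Ico p (p + δ / 2), |X t - X p| ≤ 2 * η) :
    (∀ t, p ≤ t → |X t - X p| ≤ 6 * η) ∨
    ∃ q, p + δ / 2 ≤ q ∧ q ≤ T ∧ (∀ t ∈ Ico q (q + δ / 2), |X t - X q| ≤ 2 * η) ∧
      ∀ t ∈ Ico p q, |X t - X p| ≤ 6 * η := by
  have exit_le : ∀ {p q θ : ℝ}, 0 < θ → p ≤ T → (∃ t, p < t ∧ θ < |X t - X p|) →
      (∀ t, p < t → θ < |X t - X p| → q ≤ t) → q ≤ T := by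
    rintro p q θ hθ hp ⟨t, hpt, ht⟩ H
    rcases le_total t T with h | h
    · exact (H t hpt ht).trans h
    · rw [hT t h] at ht
      refine H T (hp.lt_of_ne ?_) ht
      rintro rfl
      rw [sub_self, abs_zero] at ht
      exact lt_asymm hθ ht
  by_cases hex : ∃ t, p < t ∧ 3 * η < |X t - X p|
  swap
  · left
    push Not at hex
    intro t ht
    rcases ht.eq_or_lt with h | h
    · simpa [← h] using hη.le
    · linarith [hex t h]
  right
  obtain ⟨q, hpq, hosc, hq, hfirst⟩ := exists_first_exit hr (by positivity) hex
  have hqT := exit_le (by positivity) hp hex hfirst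
  have hgap : p + δ / 2 ≤ q := by
    by_contra! h
    linarith [hgood q ⟨hpq.le, h⟩]
  by_cases hqg : ∀ t ∈ Ico q (q + δ / 2), |X t - X q| ≤ 2 * η
  · exact ⟨q, hgap, hqT, hqg, fun t ht => by linarith [hosc t ht]⟩
  push Not at hqg
  obtain ⟨u, hu, huq⟩ := hqg
  have hqu : q < u := by
    refine hu.1.lt_of_ne ?_
    rintro rfl
    rw [sub_self, abs_zero] at huq
    linarith
  obtain ⟨q', hqq', hosc', hq', hfirst'⟩ := exists_first_exit hr (by positivity) ⟨u, hqu, huq⟩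
  have hq'u := hfirst' u hqu huq
  refine ⟨q', by linarith, exit_le (by positivity) hqT ⟨u, hqu, huq⟩ hfirst', ?_, ?_⟩
  · intro v hv
    rcases hv.1.eq_or_lt with h | h
    · simpa [← h] using hη.le
    · rcases min_le_iff.1 (hw q q' v hqq' h (by linarith [hv.2, hu.2])) with h | h <;> linarith
  · intro t ht
    rcases lt_or_ge t q with h | h
    · linarith [hosc t ⟨ht.1, h⟩]
    have h1 := hosc' t ⟨h, ht.2⟩
    have h2 := hosc (q - δ / 4) ⟨by linarith, by linarith⟩
    have h3 : |X q - X (q - δ / 4)| ≤ η := by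
      rcases min_le_iff.1 (hw (q - δ / 4) q u (by linarith) hqu (by linarith [hu.2])) with h | h
      · exact h
      · linarith
    rw [abs_le] at h1 h2 h3 ⊢
    constructor <;> linarith

/-- A grid of `[a, b]` with mesh at least `δ`, continued by the constant `b` once `b` is
reached. -/
structure IsGrid (a b δ : ℝ) (τ : ℕ → ℝ) : Prop where
  zero : τ 0 = a
  le : ∀ i, τ i ≤ b
  step : ∀ i, (τ i = b ∧ τ (i + 1) = b) ∨ τ i + δ ≤ τ (i + 1)

theorem exists_grid {X : ℝ → ℝ} (hr : ∀ c, Tendsto X (𝓝[>] c) (𝓝 (X c))) {a b T δ η : ℝ}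
    (hη : 0 < η) (hδ : 0 < δ) (hT : ∀ t, T ≤ t → X t = X T)
    (hw : ∀ s t u, s < t → t < u → u - s < δ → min |X t - X s| |X u - X t| ≤ η)
    (haT : a ≤ T) (hTb : T + δ / 2 ≤ b) (ha : ∀ t ∈ Ico a (a + δ / 2), X t = X a) :
    ∃ τ, IsGrid a b (δ / 2) τ ∧
      ∀ i, ∀ t ∈ Ico (τ i) (τ (i + 1)), |X t - X (τ i)| ≤ 6 * η := by
  let S : Set ℝ := {p | p = b ∨ p ≤ T ∧ ∀ t ∈ Ico p (p + δ / 2), |X t - X p| ≤ 2 * η}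
  have hstep : ∀ p : S, ∃ q : S, (((p : ℝ) = b ∧ (q : ℝ) = b) ∨ (p : ℝ) + δ / 2 ≤ q) ∧
      ∀ t ∈ Ico (p : ℝ) q, |X t - X p| ≤ 6 * η := by
    rintro ⟨p, hp | ⟨hp, hgood⟩⟩
    · exact ⟨⟨b, Or.inl rfl⟩, Or.inl ⟨hp, rfl⟩, fun t ht => by simp [hp] at ht⟩
    · rcases exists_next_time hr hη hδ hT hw hp hgood with h | ⟨q, h1, h2, h3, h4⟩
      · exact ⟨⟨b, Or.inl rfl⟩, Or.inr (by simp only; linarith), fun t ht => h t ht.1⟩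
      · exact ⟨⟨q, Or.inr ⟨h2, h3⟩⟩, Or.inr h1, h4⟩
  choose f hf hosc using hstep
  have haS : a ∈ S := Or.inr ⟨haT, fun t ht => by simp [ha t ht, hη.le]⟩
  refine ⟨fun i => (f^[i] ⟨a, haS⟩ : S), ⟨rfl, fun i => ?_, fun i => ?_⟩, fun i => ?_⟩
  · rcases (f^[i] ⟨a, haS⟩).2 with h | h
    · exact h.le
    · linarith [h.1]
  · simp only [Function.iterate_succ_apply']
    exact hf _
  · simp only [Function.iterate_succ_apply']
    exact hosc _

namespace IsGrid

variable {a b δ : ℝ} {τ σ : ℕ → ℝ}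

theorem monotone (hδ : 0 < δ) (h : IsGrid a b δ τ) : Monotone τ := by
  refine monotone_nat_of_le_succ fun i => ?_
  rcases h.step i with h | h
  · rw [h.1, h.2]
  · linarith

theorem mem_Icc (hδ : 0 < δ) (h : IsGrid a b δ τ) (i : ℕ) : τ i ∈ Icc a b :=
  ⟨h.zero.symm.trans_le (h.monotone hδ (Nat.zero_le i)), h.le i⟩

theorem eq_or_add_le (hδ : 0 < δ) (h : IsGrid a b δ τ) {i j : ℕ} (hij : i < j) :
    (τ i = b ∧ τ j = b) ∨ τ i + δ ≤ τ j := by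
  have hmono := h.monotone hδ (Nat.succ_le_of_lt hij)
  rcases h.step i with h' | h'
  · exact Or.inl ⟨h'.1, le_antisymm (h.le j) (h'.2.symm.trans_le hmono)⟩
  · exact Or.inr (h'.trans hmono)

theorem eq_of_mul_gt (hδ : 0 < δ) (h : IsGrid a b δ τ) {i : ℕ} (hi : b < a + i * δ) : τ i = b := by
  have key : ∀ i : ℕ, τ i = b ∨ a + i * δ ≤ τ i := by
    intro i
    induction i with
    | zero => exact Or.inr (by simp [h.zero])
    | succ i ih =>
      rcases h.step i with h' | h'
      · exact Or.inl h'.2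
      · rcases ih with ih | ih
        · have := h.le (i + 1)
          linarith
        · right
          push_cast
          linarith
  rcases key i with h' | h'
  · exact h'
  · linarith [h.le i]

theorem exists_forall_eq (hδ : 0 < δ) :
    ∃ N : ℕ, ∀ τ, IsGrid a b δ τ → ∀ i, N ≤ i → τ i = b := by
  obtain ⟨N, hN⟩ := exists_nat_gt ((b - a) / δ)
  rw [div_lt_iff₀ hδ] at hN
  refine ⟨N, fun τ h i hi => ?_⟩
  have := h.monotone hδ hi
  rw [h.eq_of_mul_gt hδ (i := N) (by linarith)] at this
  exact le_antisymm (h.le i) this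

theorem exists_mem_Ico (hδ : 0 < δ) (h : IsGrid a b δ τ) {t : ℝ} (ht : t ∈ Ico a b) :
    ∃ i, t ∈ Ico (τ i) (τ (i + 1)) := by
  classical
  obtain ⟨N, hN⟩ := exists_forall_eq (a := a) (b := b) hδ
  have hex : ∃ i, t < τ i := ⟨N, by rw [hN τ h N le_rfl]; exact ht.2⟩
  obtain ⟨i, hi⟩ := Nat.exists_eq_succ_of_ne_zero (n := Nat.find hex) fun h0 => by
    have := Nat.find_spec hex
    rw [h0, h.zero] at this
    exact absurd ht.1 (not_le.2 this)
  refine ⟨i, not_lt.1 (Nat.find_min hex (by omega)), ?_⟩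
  have := Nat.find_spec hex
  rwa [hi] at this

theorem exists_mem_Ioc (hδ : 0 < δ) (h : IsGrid a b δ τ) {t : ℝ} (ht : t ∈ Ioc a b) :
    ∃ i, t ∈ Ioc (τ i) (τ (i + 1)) := by
  classical
  obtain ⟨N, hN⟩ := exists_forall_eq (a := a) (b := b) hδ
  have hex : ∃ i, t ≤ τ i := ⟨N, by rw [hN τ h N le_rfl]; exact ht.2⟩
  obtain ⟨i, hi⟩ := Nat.exists_eq_succ_of_ne_zero (n := Nat.find hex) fun h0 => by
    have := Nat.find_spec hex
    rw [h0, h.zero] at this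
    exact absurd ht.1 (not_lt.2 this)
  refine ⟨i, not_le.1 (Nat.find_min hex (by omega)), ?_⟩
  have := Nat.find_spec hex
  rwa [hi] at this

theorem of_tendsto {ρ : ℕ → ℕ → ℝ} (h : ∀ n, IsGrid a b δ (ρ n))
    (hlim : ∀ i, Tendsto (fun n => ρ n i) atTop (𝓝 (τ i))) : IsGrid a b δ τ where
  zero := tendsto_nhds_unique (hlim 0) (by simp [(h _).zero])
  le i := le_of_tendsto' (hlim i) fun n => (h n).le i
  step i := by
    have hcl : IsClosed {z : ℝ × ℝ | (z.1 = b ∧ z.2 = b) ∨ z.1 + δ ≤ z.2} :=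
      ((isClosed_eq continuous_fst continuous_const).inter
        (isClosed_eq continuous_snd continuous_const)).union
        (isClosed_le (continuous_fst.add continuous_const) continuous_snd)
    exact hcl.mem_of_tendsto ((hlim i).prodMk_nhds (hlim (i + 1)))
      (Eventually.of_forall fun n => (h n).step i)

theorem eventually_forall_abs_sub_le (hδ : 0 < δ) {ρ : ℕ → ℕ → ℝ} (h : ∀ n, IsGrid a b δ (ρ n))
    (hlim : ∀ i, Tendsto (fun n => ρ n i) atTop (𝓝 (τ i))) {θ : ℝ} (hθ : 0 < θ) :
    ∀ᶠ n in atTop, ∀ i, |ρ n i - τ i| ≤ θ := by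
  obtain ⟨N, hN⟩ := exists_forall_eq (a := a) (b := b) hδ
  have hev : ∀ᶠ n in atTop, ∀ i ∈ Finset.range N, |ρ n i - τ i| ≤ θ := by
    rw [Filter.eventually_all_finset]
    intro i _
    filter_upwards [(hlim i) (Metric.ball_mem_nhds _ hθ)] with n hn
    exact le_of_lt hn
  filter_upwards [hev] with n hn i
  rcases lt_or_ge i N with hi | hi
  · exact hn i (Finset.mem_range.2 hi)
  · rw [hN _ (h n) i hi, hN _ (of_tendsto h hlim) i hi, sub_self, abs_zero]
    exact hθ.le

/-- The displacement between two close grids is Lipschitz. -/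
theorem abs_displacement_sub_le (hδ : 0 < δ) (hτ : IsGrid a b δ τ) (hσ : IsGrid a b δ σ) {κ : ℝ}
    (hκ : 0 ≤ κ) (hκ1 : κ < 1) (hd : ∀ i, |τ i - σ i| ≤ κ * δ / 2) (i j : ℕ) :
    |(σ i - τ i) - (σ j - τ j)| ≤ κ * |τ i - τ j| := by
  have hlt : ∀ i j, i < j → |(σ i - τ i) - (σ j - τ j)| ≤ κ * |τ i - τ j| := by
    intro i j hij
    have hi := abs_le.1 (hd i)
    have hj := abs_le.1 (hd j)
    rcases hτ.eq_or_add_le hδ hij with h | h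
    · rcases hσ.eq_or_add_le hδ hij with h' | h'
      · rw [h.1, h.2, h'.1, h'.2, sub_self, abs_zero]
        simp
      · have := hσ.le j
        nlinarith
    · have h1 : κ * δ ≤ κ * |τ i - τ j| := by
        refine mul_le_mul_of_nonneg_left ?_ hκ
        rw [abs_sub_comm]
        exact le_trans (by linarith) (le_abs_self _)
      refine le_trans ?_ h1
      rw [abs_le]
      constructor <;> linarith
  rcases lt_trichotomy i j with h | rfl | h
  · exact hlt i j h
  · simp
  · rw [abs_sub_comm, abs_sub_comm (τ i)]
    exact hlt j i h

end IsGrid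

theorem exists_lipschitz_interpolation {κ : NNReal} {p d : ℕ → ℝ}
    (h : ∀ i j, |d i - d j| ≤ κ * |p i - p j|) :
    ∃ g : ℝ → ℝ, LipschitzWith κ g ∧ ∀ i, g (p i) = d i := by
  have hinv : ∀ t : range p, ∃ i, p i = t := fun t => t.2
  choose k hk using hinv
  classical
  let g₀ : ℝ → ℝ := fun t => if ht : t ∈ range p then d (k ⟨t, ht⟩) else 0
  have hg₀ : ∀ i, g₀ (p i) = d i := by
    intro i
    have hi : p i ∈ range p := mem_range_self i
    have h1 := h (k ⟨p i, hi⟩) i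
    rw [hk, sub_self, abs_zero, mul_zero] at h1
    simp only [g₀, dif_pos hi]
    exact sub_eq_zero.1 (abs_eq_zero.1 (le_antisymm h1 (abs_nonneg _)))
  have hlip : LipschitzOnWith κ g₀ (range p) := by
    refine LipschitzOnWith.of_dist_le_mul ?_
    rintro _ ⟨i, rfl⟩ _ ⟨j, rfl⟩
    rw [hg₀, hg₀, Real.dist_eq, Real.dist_eq]
    exact h i j
  obtain ⟨g, hg, hgeq⟩ := hlip.extend_real
  exact ⟨g, hg, fun i => by rw [← hgeq (mem_range_self i), hg₀]⟩

/-- A perturbation of the identity with small Lipschitz constant is a time change whose slopes are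
close to one. -/
theorem timeChange_add_of_lipschitz {a b : ℝ} {κ : NNReal} (hκ : (κ : ℝ) ≤ 1 / 2)
    {g : ℝ → ℝ} (hg : LipschitzWith κ g) (ha : g a = 0) (hb : g b = 0) :
    StrictMono (fun t => t + g t) ∧ TimeChange a b (fun t => t + g t) ∧
      ∀ s t, s < t → |Real.log (((t + g t) - (s + g s)) / (t - s))| ≤ 2 * κ := by
  have hlip : ∀ s t, s < t → |g t - g s| ≤ κ * (t - s) := by
    intro s t hst
    have := hg.dist_le_mul t s
    rwa [Real.dist_eq, Real.dist_eq, abs_of_pos (sub_pos.2 hst)] at this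
  have hκ0 : (0 : ℝ) ≤ κ := κ.2
  have hmono : StrictMono (fun t => t + g t) := by
    intro s t hst
    have := abs_le.1 (hlip s t hst)
    simp only
    nlinarith
  refine ⟨hmono, ⟨(continuous_id.add hg.continuous).continuousOn, hmono.strictMonoOn _,
    by simp [ha], by simp [hb], fun t ht => ⟨?_, ?_⟩⟩, fun s t hst => ?_⟩
  · simpa [ha] using hmono.monotone ht.1
  · simpa [hb] using hmono.monotone ht.2
  · have h0 : 0 < t - s := sub_pos.2 hst
    have h1 := abs_le.1 (hlip s t hst)
    have hup : ((t + g t) - (s + g s)) / (t - s) ≤ 1 + κ := by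
      rw [div_le_iff₀ h0]
      linarith
    have hlo : 1 - κ ≤ ((t + g t) - (s + g s)) / (t - s) := by
      rw [le_div_iff₀ h0]
      linarith
    set z := ((t + g t) - (s + g s)) / (t - s)
    have hz : 0 < z := by linarith
    rw [abs_le]
    constructor
    · have h2 := Real.one_sub_inv_le_log_of_pos hz
      have h3 : z⁻¹ ≤ 1 + 2 * κ := by
        rw [inv_le_iff_one_le_mul₀ hz]
        nlinarith
      linarith
    · linarith [Real.log_le_sub_one_of_pos hz]

/-- Functions `X n` with partitions `σ m n` on whose cells `X n` oscillates at most `η m`, such that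
for each `m` the partitions and the values at their points converge. -/
structure SkeletonLimit (a b : ℝ) (δ η : ℕ → ℝ) (X : ℕ → ℝ → ℝ) (σ : ℕ → ℕ → ℕ → ℝ)
    (τ A : ℕ → ℕ → ℝ) : Prop where
  mesh_pos : ∀ m, 0 < δ m
  tendsto_zero : Tendsto η atTop (𝓝 0)
  pos : ∀ m, 0 < η m
  grid : ∀ m n, IsGrid a b (δ m) (σ m n)
  osc : ∀ m n i, ∀ t ∈ Ico (σ m n i) (σ m n (i + 1)), |X n t - X n (σ m n i)| ≤ η m
  tendsto_time : ∀ m i, Tendsto (fun n => σ m n i) atTop (𝓝 (τ m i))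
  tendsto_value : ∀ m i, Tendsto (fun n => X n (σ m n i)) atTop (𝓝 (A m i))

namespace SkeletonLimit

variable {a b : ℝ} {δ η : ℕ → ℝ} {X : ℕ → ℝ → ℝ} {σ : ℕ → ℕ → ℕ → ℝ} {τ A : ℕ → ℕ → ℝ}

theorem grid_limit (h : SkeletonLimit a b δ η X σ τ A) (m : ℕ) : IsGrid a b (δ m) (τ m) :=
  IsGrid.of_tendsto (h.grid m) (h.tendsto_time m)

theorem eventually_osc (h : SkeletonLimit a b δ η X σ τ A) {m i : ℕ} {t : ℝ}
    (ht : t ∈ Ioo (τ m i) (τ m (i + 1))) : ∀ᶠ n in atTop, |X n t - X n (σ m n i)| ≤ η m := by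
  filter_upwards [(h.tendsto_time m i).eventually_lt_const ht.1,
    (h.tendsto_time m (i + 1)).eventually_const_lt ht.2] with n h1 h2
  exact h.osc m n i t ⟨h1.le, h2⟩

theorem abs_value_sub_le (h : SkeletonLimit a b δ η X σ τ A) {m m' i j : ℕ} {t : ℝ}
    (hi : t ∈ Ico (τ m i) (τ m (i + 1))) (hj : t ∈ Ico (τ m' j) (τ m' (j + 1))) :
    |A m i - A m' j| ≤ η m + η m' := by
  obtain ⟨s, hts, hs⟩ := exists_between (lt_min hi.2 hj.2)
  rw [lt_min_iff] at hs
  refine le_of_tendsto ((h.tendsto_value m i).sub (h.tendsto_value m' j)).abs ?_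
  filter_upwards [h.eventually_osc ⟨hi.1.trans_lt hts, hs.1⟩,
    h.eventually_osc ⟨hj.1.trans_lt hts, hs.2⟩] with n h1 h2
  rw [abs_le] at h1 h2 ⊢
  constructor <;> linarith

theorem abs_value_sub_le_of_tendsto (h : SkeletonLimit a b δ η X σ τ A) {m i : ℕ} {t c v : ℝ}
    (hi : t ∈ Ico (τ m i) (τ m (i + 1))) (htc : t < c)
    (hv : ∀ s ∈ Ioo t c, Tendsto (fun n => X n s) atTop (𝓝 v)) : |v - A m i| ≤ η m := by
  obtain ⟨s, hts, hs⟩ := exists_between (lt_min hi.2 htc)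
  rw [lt_min_iff] at hs
  exact le_of_tendsto ((hv s ⟨hts, hs.2⟩).sub (h.tendsto_value m i)).abs
    (h.eventually_osc ⟨hi.1.trans_lt hts, hs.1⟩)

theorem exists_limit_value (h : SkeletonLimit a b δ η X σ τ A) {t : ℝ} (ht : t ∈ Ico a b) :
    ∃ v, ∀ m i, t ∈ Ico (τ m i) (τ m (i + 1)) → |v - A m i| ≤ η m := by
  choose k hk using fun m => (h.grid_limit m).exists_mem_Ico (h.mesh_pos m) ht
  have hcauchy : CauchySeq fun m => A m (k m) := by
    rw [Metric.cauchySeq_iff]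
    intro θ hθ
    obtain ⟨N, hN⟩ := eventually_atTop.1 (h.tendsto_zero.eventually_lt_const (half_pos hθ))
    refine ⟨N, fun m hm m' hm' => ?_⟩
    rw [Real.dist_eq]
    linarith [h.abs_value_sub_le (hk m) (hk m'), hN m hm, hN m' hm']
  obtain ⟨v, hv⟩ := cauchySeq_tendsto_of_complete hcauchy
  refine ⟨v, fun m i hi => ?_⟩
  have hlim : Tendsto (fun m' => η m' + η m) atTop (𝓝 (0 + η m)) :=
    h.tendsto_zero.add_const _
  rw [zero_add] at hlim
  exact le_of_tendsto_of_tendsto' (hv.sub_const (A m i)).abs hlim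
    fun m' => h.abs_value_sub_le (hk m') hi

theorem exists_limit (h : SkeletonLimit a b δ η X σ τ A) :
    ∃ Y : ℝ → ℝ, (∀ m i, ∀ t ∈ Ico (τ m i) (τ m (i + 1)), |Y t - A m i| ≤ η m) ∧
      Tendsto (fun n => X n b) atTop (𝓝 (Y b)) := by
  have hval : ∀ t : ℝ, ∃ v, t ∈ Ico a b → ∀ m i, t ∈ Ico (τ m i) (τ m (i + 1)) →
      |v - A m i| ≤ η m := by
    intro t
    by_cases ht : t ∈ Ico a b
    · obtain ⟨v, hv⟩ := h.exists_limit_value ht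
      exact ⟨v, fun _ => hv⟩
    · exact ⟨0, fun h' => absurd h' ht⟩
  choose Y hY using hval
  obtain ⟨N, hN⟩ := IsGrid.exists_forall_eq (a := a) (b := b) (h.mesh_pos 0)
  refine ⟨Function.update Y b (A 0 N), fun m i t ht => ?_, ?_⟩
  · have hab : t ∈ Ico a b := ⟨((h.grid_limit m).mem_Icc (h.mesh_pos m) i).1.trans ht.1,
      ht.2.trans_le ((h.grid_limit m).le (i + 1))⟩
    rw [Function.update_of_ne hab.2.ne]
    exact hY t hab m i ht
  · rw [Function.update_self]
    exact (h.tendsto_value 0 N).congr fun n => by rw [hN _ (h.grid 0 n) N le_rfl]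

variable {Y : ℝ → ℝ}

theorem abs_sub_le_of_mem_cell
    (hY : ∀ m i, ∀ t ∈ Ico (τ m i) (τ m (i + 1)), |Y t - A m i| ≤ η m) {m i : ℕ} {s t : ℝ}
    (hs : s ∈ Ico (τ m i) (τ m (i + 1))) (ht : t ∈ Ico (τ m i) (τ m (i + 1))) :
    |Y s - Y t| ≤ 2 * η m := by
  have h1 := abs_le.1 (hY m i s hs)
  have h2 := abs_le.1 (hY m i t ht)
  rw [abs_le]
  constructor <;> linarith

theorem tendsto_right (h : SkeletonLimit a b δ η X σ τ A)
    (hY : ∀ m i, ∀ t ∈ Ico (τ m i) (τ m (i + 1)), |Y t - A m i| ≤ η m) {t : ℝ}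
    (ht : t ∈ Ico a b) : Tendsto Y (𝓝[>] t) (𝓝 (Y t)) := by
  rw [Metric.tendsto_nhds]
  intro θ hθ
  obtain ⟨m, hm⟩ := (h.tendsto_zero.eventually_lt_const (half_pos hθ)).exists
  obtain ⟨i, hi⟩ := (h.grid_limit m).exists_mem_Ico (h.mesh_pos m) ht
  filter_upwards [Ioo_mem_nhdsGT hi.2] with s hs
  rw [Real.dist_eq]
  linarith [abs_sub_le_of_mem_cell hY ⟨hi.1.trans hs.1.le, hs.2⟩ hi]

theorem tendsto_left (h : SkeletonLimit a b δ η X σ τ A)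
    (hY : ∀ m i, ∀ t ∈ Ico (τ m i) (τ m (i + 1)), |Y t - A m i| ≤ η m) {t : ℝ}
    (ht : t ∈ Ioc a b) : ∃ L, Tendsto Y (𝓝[<] t) (𝓝 L) := by
  rw [← cauchy_map_iff_exists_tendsto, Metric.cauchy_iff]
  refine ⟨inferInstance, fun θ hθ => ?_⟩
  obtain ⟨m, hm⟩ := (h.tendsto_zero.eventually_lt_const (half_pos hθ)).exists
  obtain ⟨i, hi⟩ := (h.grid_limit m).exists_mem_Ioc (h.mesh_pos m) ht
  refine ⟨_, image_mem_map (Ioo_mem_nhdsLT hi.1), ?_⟩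
  rintro _ ⟨s, hs, rfl⟩ _ ⟨u, hu, rfl⟩
  rw [Real.dist_eq]
  linarith [abs_sub_le_of_mem_cell hY ⟨hs.1.le, hs.2.trans_le hi.2⟩
    ⟨hu.1.le, hu.2.trans_le hi.2⟩]

theorem eq_of_tendsto (h : SkeletonLimit a b δ η X σ τ A)
    (hY : ∀ m i, ∀ t ∈ Ico (τ m i) (τ m (i + 1)), |Y t - A m i| ≤ η m) {t c v : ℝ}
    (ht : t ∈ Ico a b) (htc : t < c)
    (hv : ∀ s ∈ Ioo t c, Tendsto (fun n => X n s) atTop (𝓝 v)) : Y t = v := by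
  refine eq_of_forall_dist_le fun θ hθ => ?_
  obtain ⟨m, hm⟩ := (h.tendsto_zero.eventually_lt_const (half_pos hθ)).exists
  obtain ⟨i, hi⟩ := (h.grid_limit m).exists_mem_Ico (h.mesh_pos m) ht
  have h1 := abs_le.1 (hY m i t hi)
  have h2 := abs_le.1 (h.abs_value_sub_le_of_tendsto hi htc hv)
  rw [Real.dist_eq, abs_le]
  constructor <;> linarith

theorem tendsto_dSk (h : SkeletonLimit a b δ η X σ τ A)
    (hY : ∀ m i, ∀ t ∈ Ico (τ m i) (τ m (i + 1)), |Y t - A m i| ≤ η m)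
    (hb : Tendsto (fun n => X n b) atTop (𝓝 (Y b))) :
    Tendsto (fun n => dSk a b (X n) Y) atTop (𝓝 0) := by
  have hbdd : ∀ x y : ℝ → ℝ, BddBelow {r : ℝ | 0 ≤ r ∧ ∃ l : ℝ → ℝ, TimeChange a b l ∧
      (∀ s ∈ Icc a b, ∀ t ∈ Icc a b, s < t → |Real.log ((l t - l s) / (t - s))| ≤ r) ∧
      (∀ t ∈ Icc a b, |x t - y (l t)| ≤ r)} := fun x y => ⟨0, fun r hr => hr.1⟩
  have hnonneg : ∀ n, 0 ≤ dSk a b (X n) Y := fun n => Real.sInf_nonneg fun r hr => hr.1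
  rw [Metric.tendsto_nhds]
  intro θ hθ
  obtain ⟨m, hm⟩ := (h.tendsto_zero.eventually_lt_const (by positivity : 0 < θ / 4)).exists
  have hδ := h.mesh_pos m
  have hη := h.pos m
  have hgrid := h.grid_limit m
  obtain ⟨N, hN⟩ := IsGrid.exists_forall_eq (a := a) (b := b) hδ
  let κ : NNReal := ⟨min (1 / 2) (θ / 4), by positivity⟩
  have hκ1 : (κ : ℝ) ≤ 1 / 2 := min_le_left _ _
  have hκ2 : (κ : ℝ) ≤ θ / 4 := min_le_right _ _
  have hκ0 : (0 : ℝ) < κ := lt_min (by positivity) (by positivity)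
  have hval : ∀ᶠ n in atTop, ∀ i ∈ Finset.range N, |X n (σ m n i) - A m i| ≤ η m := by
    rw [Filter.eventually_all_finset]
    intro i _
    filter_upwards [h.tendsto_value m i (Metric.ball_mem_nhds _ hη)] with n hn
    exact le_of_lt hn
  filter_upwards [IsGrid.eventually_forall_abs_sub_le hδ (h.grid m) (h.tendsto_time m)
    (by positivity : 0 < κ * δ m / 2), hval, hb (Metric.ball_mem_nhds _ hη)] with n h1 h2 h3
  obtain ⟨g, hg, hgi⟩ := exists_lipschitz_interpolation (κ := κ) (p := σ m n)
    (d := fun i => τ m i - σ m n i)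
    (IsGrid.abs_displacement_sub_le hδ (h.grid m n) hgrid hκ0.le (by linarith) h1)
  have hga : g a = 0 := by
    have := hgi 0
    rwa [(h.grid m n).zero, hgrid.zero, sub_self] at this
  have hgb : g b = 0 := by
    have := hgi N
    rwa [hN _ (h.grid m n) N le_rfl, hN _ hgrid N le_rfl, sub_self] at this
  obtain ⟨hmono, hl, hlog⟩ := timeChange_add_of_lipschitz hκ1 hg hga hgb
  have hle : dSk a b (X n) Y ≤ 3 * (θ / 4) := by
    refine csInf_le (hbdd _ _) ⟨by positivity, _, hl, fun s _ t _ hst => ?_, fun t ht => ?_⟩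
    · linarith [hlog s t hst]
    · rcases ht.2.eq_or_lt with rfl | htb
      · simp only [hgb, add_zero]
        have h3' : |X n t - Y t| < η m := h3
        linarith
      · obtain ⟨i, hi⟩ := (h.grid m n).exists_mem_Ico hδ ⟨ht.1, htb⟩
        have hiN : i < N := by
          by_contra! hNi
          rw [hN _ (h.grid m n) i hNi] at hi
          exact absurd hi.1 (not_le.2 htb)
        have hli : ∀ j, σ m n j + g (σ m n j) = τ m j := fun j => by rw [hgi]; ring
        have hcell : t + g t ∈ Ico (τ m i) (τ m (i + 1)) := by
          rw [← hli i, ← hli (i + 1)]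
          exact ⟨hmono.monotone hi.1, hmono hi.2⟩
        have e1 := abs_le.1 (h.osc m n i t hi)
        have e2 := abs_le.1 (h2 i (Finset.mem_range.2 hiN))
        have e3 := abs_le.1 (hY m i _ hcell)
        rw [abs_le]
        constructor <;> linarith
  rw [Real.dist_eq, sub_zero, abs_of_nonneg (hnonneg n)]
  linarith

end SkeletonLimit

theorem min_abs_sub_extFn_le {T δ η : ℝ} (hT : 0 < T) (hη : 0 ≤ η) {x : ℝ → ℝ}
    (h1 : ∀ s t u : ℝ, 0 ≤ s → s < t → t < u → u ≤ T → u - s < δ →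
      min |x t - x s| |x u - x t| ≤ η)
    (h2 : ∀ t u : ℝ, 0 ≤ t → t < u → u ≤ T → u < δ → min |x t| |x u - x t| ≤ η)
    {s t u : ℝ} (hst : s < t) (htu : t < u) (hus : u - s < δ) :
    min |extFn T x t - extFn T x s| |extFn T x u - extFn T x t| ≤ η := by
  rcases lt_or_ge t 0 with ht | ht
  · rw [extFn_of_neg x ht, extFn_of_neg x (hst.trans ht)]
    exact min_le_of_left_le (by simpa using hη)
  rcases le_or_gt T t with htT | htT
  · rw [extFn_of_ge hT.le x htT, extFn_of_ge hT.le x (htT.trans htu.le)]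
    exact min_le_of_right_le (by simpa using hη)
  have hu : extFn T x u = x (min u T) := by
    rcases le_total u T with h | h
    · rw [min_eq_left h, extFn_of_mem x ⟨by linarith, h⟩]
    · rw [min_eq_right h, extFn_of_ge hT.le x h]
  have hle := min_le_left u T
  rw [hu, extFn_of_mem x ⟨ht, htT.le⟩]
  rcases lt_or_ge s 0 with hs | hs
  · rw [extFn_of_neg x hs, sub_zero]
    exact h2 t _ ht (lt_min htu htT) (min_le_right _ _) (by linarith)
  · rw [extFn_of_mem x ⟨hs, by linarith⟩]
    exact h1 s t _ hs hst (lt_min htu htT) (min_le_right _ _) (by linarith)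

theorem relSeqCompact_of_modulus {T ε M : ℝ} (hT : 0 < T) (hε : 0 < ε) {K : Set (ℝ → ℝ)}
    (hK : ∀ x ∈ K, Cadlag T x) (hM : ∀ x ∈ K, ∀ t ∈ Icc (0 : ℝ) T, |x t| ≤ M)
    (hmod : ∀ η > (0:ℝ), ∃ δ > (0:ℝ), ∀ x ∈ K,
        (∀ s t u : ℝ, 0 ≤ s → s < t → t < u → u ≤ T → u - s < δ →
          min |x t - x s| |x u - x t| ≤ η) ∧
        (∀ t u : ℝ, 0 ≤ t → t < u → u ≤ T → u < δ →
          min |x t| |x u - x t| ≤ η)) : RelSeqCompact T ε K := by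
  intro x hxK
  have hgrid : ∀ m : ℕ, ∃ δ > 0, ∀ n, ∃ σ, IsGrid (-ε) (T + ε) δ σ ∧
      ∀ i, ∀ t ∈ Ico (σ i) (σ (i + 1)),
        |extFn T (x n) t - extFn T (x n) (σ i)| ≤ 1 / ((m : ℝ) + 1) := by
    intro m
    have hη : 0 < 1 / ((m : ℝ) + 1) / 6 := by positivity
    obtain ⟨δ, hδ, H⟩ := hmod _ hη
    have hδε : 0 < min δ ε := lt_min hδ hε
    have hle := min_le_right δ ε
    refine ⟨min δ ε / 2, by positivity, fun n => ?_⟩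
    obtain ⟨σ, hσ, hosc⟩ := exists_grid (X := extFn T (x n)) (a := -ε) (b := T + ε) (T := T)
      (fun c => (hK _ (hxK n)).tendsto_extFn_right hT c) hη hδε
      (fun t ht => by rw [extFn_of_ge hT.le _ ht, extFn_of_ge hT.le _ le_rfl])
      (fun s t u hst htu hus => min_abs_sub_extFn_le hT hη.le (H _ (hxK n)).1 (H _ (hxK n)).2
        hst htu (hus.trans_le (min_le_left _ _)))
      (by linarith) (by linarith)
      (fun t ht => by rw [extFn_of_neg _ (by linarith [ht.2]), extFn_of_neg _ (by linarith)])
    refine ⟨σ, hσ, fun i t ht => (hosc i t ht).trans (by linarith)⟩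
  choose δ hδ σ hσ hosc using hgrid
  have hM0 : 0 ≤ M := (abs_nonneg _).trans (hM _ (hxK 0) 0 ⟨le_rfl, hT.le⟩)
  have hbound : ∀ n t, |extFn T (x n) t| ≤ M := by
    intro n t
    rcases lt_or_ge t 0 with h | h
    · rwa [extFn_of_neg _ h, abs_zero]
    rcases le_total t T with h' | h'
    · rw [extFn_of_mem _ ⟨h, h'⟩]
      exact hM _ (hxK n) t ⟨h, h'⟩
    · rw [extFn_of_ge hT.le _ h']
      exact hM _ (hxK n) T ⟨hT.le, le_rfl⟩
  have hcpt : IsCompact (univ.pi fun _ : ℕ => univ.pi fun _ : ℕ =>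
      Icc (-ε) (T + ε) ×ˢ Icc (-M) M) :=
    isCompact_univ_pi fun _ => isCompact_univ_pi fun _ => isCompact_Icc.prod isCompact_Icc
  obtain ⟨z, -, φ, hφ, hz⟩ := hcpt.tendsto_subseq
    (x := fun n m i => (σ m n i, extFn T (x n) (σ m n i)))
    (fun n m _ i _ => ⟨(hσ m n).mem_Icc (hδ m) i, abs_le.1 (hbound n _)⟩)
  have hz' : ∀ m i, Tendsto (fun n => (σ m (φ n) i, extFn T (x (φ n)) (σ m (φ n) i))) atTop
      (𝓝 (z m i)) := fun m i => tendsto_pi_nhds.1 (tendsto_pi_nhds.1 hz m) i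
  have h : SkeletonLimit (-ε) (T + ε) δ (fun m => 1 / ((m : ℝ) + 1))
      (fun n => extFn T (x (φ n))) (fun m n => σ m (φ n)) (fun m i => (z m i).1)
      (fun m i => (z m i).2) :=
    { mesh_pos := hδ
      tendsto_zero := tendsto_one_div_add_atTop_nhds_zero_nat
      pos := fun m => Nat.one_div_pos_of_nat
      grid := fun m n => hσ m (φ n)
      osc := fun m n => hosc m (φ n)
      tendsto_time := fun m i => (hz' m i).fst_nhds
      tendsto_value := fun m i => (hz' m i).snd_nhds }
  obtain ⟨Y, hY, hYb⟩ := h.exists_limit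
  have hYneg : ∀ t ∈ Ico (-ε) 0, Y t = 0 := fun t ht =>
    h.eq_of_tendsto hY ⟨ht.1, by linarith [ht.2]⟩ ht.2 fun s hs =>
      tendsto_const_nhds.congr fun n => (extFn_of_neg _ hs.2).symm
  have hYge : ∀ t ∈ Icc T (T + ε), Y t = Y (T + ε) := by
    intro t ht
    rcases ht.2.eq_or_lt with rfl | htb
    · rfl
    · refine h.eq_of_tendsto hY ⟨by linarith [ht.1], htb⟩ htb fun s hs => hYb.congr fun n => ?_
      rw [extFn_of_ge hT.le _ (by linarith), extFn_of_ge hT.le _ (ht.1.trans hs.1.le)]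
  have hext : ∀ t ∈ Icc (-ε) (T + ε), extFn T Y t = Y t := by
    intro t ht
    rcases lt_or_ge t 0 with h0 | h0
    · rw [extFn_of_neg _ h0, hYneg t ⟨ht.1, h0⟩]
    rcases le_total t T with h' | h'
    · exact extFn_of_mem _ ⟨h0, h'⟩
    · rw [extFn_of_ge hT.le _ h', hYge t ⟨h', ht.2⟩, hYge T ⟨le_rfl, by linarith⟩]
  refine ⟨φ, hφ, Y,
    ⟨fun t ht => h.tendsto_right hY ⟨by linarith [ht.1], by linarith [ht.2]⟩,
      fun t ht => h.tendsto_left hY ⟨by linarith [ht.1], by linarith [ht.2]⟩⟩, ?_⟩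
  refine h.tendsto_dSk (fun m i t ht => ?_) ?_
  · rw [hext t ⟨((h.grid_limit m).mem_Icc (hδ m) i).1.trans ht.1,
      ht.2.le.trans ((h.grid_limit m).le (i + 1))⟩]
    exact hY m i t ht
  · rw [hext _ ⟨by linarith, le_rfl⟩]
    exact hYb

/-- Theorem 4.8 (ii): criterion of relative `mJ₁`-compactness. -/
theorem stmt9 (T : ℝ) (hT : 0 < T) (ε : ℝ) (hε : 0 < ε)
    (K : Set (ℝ → ℝ)) (hK : ∀ x ∈ K, Cadlag T x) :
    (∀ x : ℕ → ℝ → ℝ, (∀ n, x n ∈ K) →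
      ∃ φ : ℕ → ℕ, StrictMono φ ∧ ∃ x₀ : ℝ → ℝ, Cadlag T x₀ ∧
        Filter.Tendsto (fun k => dmJ T ε (x (φ k)) x₀) Filter.atTop (nhds 0))
    ↔
    ((∃ M : ℝ, ∀ x ∈ K, ∀ t ∈ Set.Icc (0:ℝ) T, |x t| ≤ M) ∧
      (∀ η > (0:ℝ), ∃ δ > (0:ℝ), ∀ x ∈ K,
        (∀ s t u : ℝ, 0 ≤ s → s < t → t < u → u ≤ T → u - s < δ →
          min |x t - x s| |x u - x t| ≤ η) ∧
        (∀ t u : ℝ, 0 ≤ t → t < u → u ≤ T → u < δ →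
          min |x t| |x u - x t| ≤ η))) := by
  constructor
  · intro (h : RelSeqCompact T ε K)
    refine ⟨h.uniformly_bounded hT hε hK, fun η hη => ?_⟩
    obtain ⟨δ, hδ, H⟩ := h.equi_modulus hT hε hK hη
    refine ⟨δ, hδ, fun x hx => ⟨fun s t u hs hst htu hu hus => ?_, fun t u ht htu hu huδ => ?_⟩⟩
    · have := H x hx s t u ⟨by linarith, by linarith⟩ hst htu hu hus
      rwa [extFn_of_mem x ⟨hs, by linarith⟩, extFn_of_mem x ⟨by linarith, by linarith⟩,
        extFn_of_mem x ⟨by linarith, hu⟩] at this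
    · obtain ⟨ρ, hρ, hρ'⟩ := exists_between (lt_min hε (sub_pos.2 huδ))
      rw [lt_min_iff] at hρ'
      have := H x hx (-ρ) t u ⟨by linarith, by linarith⟩ (by linarith) htu hu (by linarith)
      rwa [extFn_of_neg x (neg_lt_zero.2 hρ), sub_zero, extFn_of_mem x ⟨ht, by linarith⟩,
        extFn_of_mem x ⟨by linarith, hu⟩] at this
  · rintro ⟨⟨M, hM⟩, hmod⟩
    exact relSeqCompact_of_modulus hT hε hK hM hmod

end
end

section
/- Relative S-compactness on the infinite time horizon (Theorem 5.2): Let K ⊆ D([0,∞)). The following statements are equivalent: (0) every sequence (x_n) of elements of K admits a subsequence ⇒*_S-converging in D([0,∞)) to some x_0 ∈ D([0,∞)); (i) for every T > 0, sup_{x ∈ K} ‖x^T‖_∞ < +∞ and, for all a < b, sup_{x ∈ K} N^{a,b}(x^T) < +∞; (ii) for every T > 0, sup_{x ∈ K} ‖x^T‖_∞ < +∞ and, for every η > 0, sup_{x ∈ K} N_η(x^T) < +∞. -/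
open MeasureTheory Filter Set Topology

noncomputable section

/-- `x : [0,∞) → ℝ` is càdlàg: right-continuous at every `t ≥ 0`, with left
limits at every `t > 0`. -/
def CadlagInf (x : ℝ → ℝ) : Prop :=
  (∀ t : ℝ, 0 ≤ t → Filter.Tendsto x (nhdsWithin t (Set.Ioi t)) (nhds (x t))) ∧
  (∀ t : ℝ, 0 < t → ∃ L : ℝ, Filter.Tendsto x (nhdsWithin t (Set.Iio t)) (nhds L))

/-- `x_n ⇒*_S x₀` in `D([0,∞))`: for every `T > 0` and all `A_n, A₀ ∈ 𝔸([0,T])`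
with `A_n →_τ A₀`, `∫_0^T x_n dA_n → ∫_0^T x₀ dA₀`. -/
def SStarConvInf (x : ℕ → ℝ → ℝ) (x₀ : ℝ → ℝ) : Prop :=
  ∀ T : ℝ, 0 < T → ∀ A : ℕ → ℝ → ℝ, ∀ A₀ : ℝ → ℝ,
    (∀ n, MemA T (A n)) → MemA T A₀ → TauConv T A A₀ →
    Filter.Tendsto (fun n => intD T (x n) (A n)) Filter.atTop (nhds (intD T x₀ A₀))

theorem HasUpcrossings.hasOscillations {T a b : ℝ} {x : ℝ → ℝ} {k : ℕ}
    (h : HasUpcrossings T a b x k) : HasOscillations T (b - a) x k := by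
  obtain ⟨s, u, h1, h2, h3⟩ := h
  refine ⟨s, u, h1, fun i j hij => (h2 i j hij).le, fun i => ?_⟩
  have := h3 i
  exact lt_of_lt_of_le (by linarith) (le_abs_self _)

theorem exists_grid_crossing {p q η M : ℝ} {R : ℕ} (hη : 0 < η) (hR : 2 * M ≤ R * (η / 3))
    (hp : |p| ≤ M) (hq : |q| ≤ M) (hpq : η < q - p) :
    ∃ r < R + 2, p < -M + r * (η / 3) ∧ -M + (r * (η / 3) + η / 3) < q := by
  have hp' := abs_le.1 hp
  have hq' := abs_le.1 hq
  have hη3 : 0 < η / 3 := by positivity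
  have hnn : 0 ≤ (p + M) / (η / 3) := div_nonneg (by linarith) hη3.le
  have h1 := Nat.floor_le hnn
  have h2 := Nat.lt_floor_add_one ((p + M) / (η / 3))
  set f := ⌊(p + M) / (η / 3)⌋₊
  rw [le_div_iff₀ hη3] at h1
  rw [div_lt_iff₀ hη3] at h2
  refine ⟨f + 1, ?_, ?_, ?_⟩
  · have : (f : ℝ) * (η / 3) ≤ R * (η / 3) := by linarith
    have : (f : ℝ) ≤ R := le_of_mul_le_mul_right this hη3
    have : f ≤ R := by exact_mod_cast this
    omega
  · push_cast; linarith
  · push_cast; linarith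

theorem card_up_le {T a b : ℝ} {x : ℝ → ℝ} {k N : ℕ} {s u : Fin k → ℝ} (hab : a < b)
    (h1 : ∀ i, 0 ≤ s i ∧ s i < u i ∧ u i ≤ T) (h2 : ∀ i j : Fin k, i < j → u i ≤ s j)
    (hN : ∀ k, HasUpcrossings T a b x k → k ≤ N) (S : Finset (Fin k))
    (hS : ∀ i ∈ S, x (s i) < a ∧ b < x (u i)) : S.card ≤ N := by
  refine hN _ ⟨fun i => s (S.orderEmbOfFin rfl i), fun i => u (S.orderEmbOfFin rfl i),
    fun i => h1 _, fun i j hij => ?_, fun i => hS _ (S.orderEmbOfFin_mem rfl i)⟩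
  refine lt_of_le_of_ne (h2 _ _ ((S.orderEmbOfFin rfl).strictMono hij)) fun h => ?_
  beta_reduce at h
  have hi := hS _ (S.orderEmbOfFin_mem rfl i)
  have hj := hS _ (S.orderEmbOfFin_mem rfl j)
  rw [h] at hi
  linarith [hi.2, hj.1]

theorem card_down_le {T a b : ℝ} {x : ℝ → ℝ} {k N : ℕ} {s u : Fin k → ℝ} (hab : a < b)
    (h1 : ∀ i, 0 ≤ s i ∧ s i < u i ∧ u i ≤ T) (h2 : ∀ i j : Fin k, i < j → u i ≤ s j)
    (hN : ∀ k, HasUpcrossings T a b x k → k ≤ N) (S : Finset (Fin k))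
    (hS : ∀ i ∈ S, x (u i) < a ∧ b < x (s i)) : S.card ≤ N + 1 := by
  rcases hc : S.card with _ | c
  · omega
  have hmem := S.orderEmbOfFin_mem hc
  have hmono := (S.orderEmbOfFin hc).strictMono
  set e := S.orderEmbOfFin hc
  have hne : ∀ i j, e i < e j → u (e i) < s (e j) := fun i j hij => by
    refine lt_of_le_of_ne (h2 _ _ hij) fun h => ?_
    have hi := hS _ (hmem i)
    have hj := hS _ (hmem j)
    rw [h] at hi
    linarith [hi.1, hj.2]
  refine Nat.succ_le_succ (hN c ⟨fun i => u (e i.castSucc), fun i => s (e i.succ), fun i => ?_,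
    fun i j hij => ?_, fun i => ⟨(hS _ (hmem _)).1, (hS _ (hmem _)).2⟩⟩)
  · refine ⟨(h1 _).1.trans (h1 _).2.1.le, hne _ _ (hmono (Fin.castSucc_lt_succ)),
      (h1 _).2.1.le.trans (h1 _).2.2⟩
  · have hle : e i.succ ≤ e j.castSucc := hmono.monotone (by
      rw [Fin.le_def]; simpa using hij)
    beta_reduce
    rcases hle.eq_or_lt with h | h
    · rw [h]; exact (h1 _).2.1
    · exact (h1 _).2.1.trans ((hne _ _ h).trans (h1 _).2.1)

theorem exists_oscillation_bound {K : Set (ℝ → ℝ)} {T M η : ℝ} (hη : 0 < η)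
    (hM : ∀ x ∈ K, ∀ t ∈ Set.Icc (0:ℝ) T, |x t| ≤ M)
    (hN : ∀ a b : ℝ, a < b → ∃ N : ℕ, ∀ x ∈ K, ∀ k : ℕ, HasUpcrossings T a b x k → k ≤ N) :
    ∃ N : ℕ, ∀ x ∈ K, ∀ k : ℕ, HasOscillations T η x k → k ≤ N := by
  obtain ⟨R, hR⟩ := exists_nat_ge (2 * M / (η / 3))
  rw [div_le_iff₀ (by positivity)] at hR
  choose N hN using fun r : ℕ =>
    hN (-M + r * (η / 3)) (-M + (r * (η / 3) + η / 3)) (by linarith)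
  refine ⟨∑ r ∈ Finset.range (R + 2), (N r + (N r + 1)), fun x hx k => ?_⟩
  rintro ⟨s, u, h1, h2, h3⟩
  classical
  let U : ℕ → Finset (Fin k) := fun r => Finset.univ.filter fun i =>
    x (s i) < -M + r * (η / 3) ∧ -M + (r * (η / 3) + η / 3) < x (u i)
  let D : ℕ → Finset (Fin k) := fun r => Finset.univ.filter fun i =>
    x (u i) < -M + r * (η / 3) ∧ -M + (r * (η / 3) + η / 3) < x (s i)
  have hcover : (Finset.univ : Finset (Fin k)) ⊆
      (Finset.range (R + 2)).biUnion fun r => U r ∪ D r := by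
    intro i _
    have hs := hM x hx (s i) ⟨(h1 i).1, (h1 i).2.1.le.trans (h1 i).2.2⟩
    have hu := hM x hx (u i) ⟨(h1 i).1.trans (h1 i).2.1.le, (h1 i).2.2⟩
    simp only [Finset.mem_biUnion, Finset.mem_range, Finset.mem_union, U, D, Finset.mem_filter,
      Finset.mem_univ, true_and]
    rcases lt_abs.1 (h3 i) with h | h
    · obtain ⟨r, hr, h⟩ := exists_grid_crossing hη hR hs hu h
      exact ⟨r, hr, Or.inl h⟩
    · obtain ⟨r, hr, h⟩ := exists_grid_crossing hη hR hu hs (by linarith)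
      exact ⟨r, hr, Or.inr h⟩
  calc k = (Finset.univ : Finset (Fin k)).card := by simp
    _ ≤ _ := Finset.card_le_card hcover
    _ ≤ _ := Finset.card_biUnion_le
    _ ≤ _ := Finset.sum_le_sum fun r _ => (Finset.card_union_le _ _).trans (Nat.add_le_add
        (card_up_le (by linarith) h1 h2 (hN r x hx) _ (by simp [U]))
        (card_down_le (by linarith) h1 h2 (hN r x hx) _ (by simp [D])))

/-- `f` is bounded and measurable on `[0,T]`. -/
def BddMeasurableOn (T : ℝ) (f : ℝ → ℝ) : Prop :=
  Measurable ((Set.Icc 0 T).indicator f) ∧ ∃ M : ℝ, ∀ t ∈ Set.Icc (0:ℝ) T, |f t| ≤ M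

theorem BddMeasurableOn.integrable {T : ℝ} {f : ℝ → ℝ} (hf : BddMeasurableOn T f)
    {P : Measure ℝ} [IsFiniteMeasure P] (hP : P (Set.Icc 0 T)ᶜ = 0) : Integrable f P := by
  obtain ⟨hm, M, hM⟩ := hf
  have hae : (Set.Icc 0 T).indicator f =ᵐ[P] f := by
    rw [Filter.EventuallyEq, ae_iff]
    refine measure_mono_null (fun t ht => ?_) hP
    intro htm
    exact ht (Set.indicator_of_mem htm f)
  refine Integrable.congr ?_ hae
  refine Integrable.of_bound hm.aestronglyMeasurable |M| (Filter.Eventually.of_forall fun t => ?_)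
  by_cases ht : t ∈ Set.Icc 0 T
  · rw [Set.indicator_of_mem ht]
    exact (hM t ht).trans (le_abs_self _)
  · simp [Set.indicator_of_notMem ht]

theorem jordan_null {μ : SignedMeasure ℝ} {S : Set ℝ} (hS : MeasurableSet S)
    (h : ∀ s, MeasurableSet s → s ⊆ S → μ s = 0) :
    μ.toJordanDecomposition.posPart S = 0 ∧ μ.toJordanDecomposition.negPart S = 0 := by
  obtain ⟨i, hi₁, hi₂, hi₃, hp, hn⟩ := μ.toJordanDecomposition_spec
  rw [hp, hn, SignedMeasure.toMeasureOfZeroLE_apply _ _ hi₁ hS,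
    SignedMeasure.toMeasureOfLEZero_apply _ _ hi₁.compl hS]
  have h1 := h (i ∩ S) (hi₁.inter hS) Set.inter_subset_right
  have h2 := h (iᶜ ∩ S) (hi₁.compl.inter hS) Set.inter_subset_right
  constructor
  · simp only [h1]; rfl
  · simp only [h2, neg_zero]; rfl

theorem real_Iic_eq {T : ℝ} {P : Measure ℝ} [IsFiniteMeasure P] (hP : P (Set.Icc 0 T)ᶜ = 0)
    (t : ℝ) : P.real (Set.Iic t) = P.real (Set.Icc 0 (min t T)) := by
  refine measureReal_congr ?_
  have : ∀ᵐ r ∂P, r ∈ Set.Icc 0 T := by rw [ae_iff]; exact hP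
  filter_upwards [this] with r hr
  apply propext
  change r ∈ Set.Iic t ↔ r ∈ Set.Icc 0 (min t T)
  simp only [Set.mem_Iic, Set.mem_Icc, le_min_iff]
  exact ⟨fun h => ⟨hr.1, h, hr.2⟩, fun h => h.2.1⟩

theorem sInt_eq_of_represents {T : ℝ} (hT : 0 ≤ T) {A f : ℝ → ℝ} {μ : SignedMeasure ℝ}
    (hμ : Represents T μ A) {P Q : Measure ℝ} [IsFiniteMeasure P] [IsFiniteMeasure Q]
    (hP : P (Set.Icc 0 T)ᶜ = 0) (hQ : Q (Set.Icc 0 T)ᶜ = 0)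
    (hPQ : ∀ t ∈ Set.Icc (0:ℝ) T, P.real (Set.Icc 0 t) - Q.real (Set.Icc 0 t) = A t)
    (hf : BddMeasurableOn T f) : sInt μ f = ∫ t, f t ∂P - ∫ t, f t ∂Q := by
  obtain ⟨hp, hn⟩ := jordan_null (μ := μ) (S := (Set.Icc 0 T)ᶜ) measurableSet_Icc.compl
    fun s hs hsub => hμ.2 s hs (by
      rw [← Set.disjoint_iff_inter_eq_empty]; exact Set.disjoint_left.2 fun r hr => hsub hr)
  have hμs : ∀ s, MeasurableSet s → μ s = μ.toJordanDecomposition.posPart.real s -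
      μ.toJordanDecomposition.negPart.real s := by
    intro s hs
    conv_lhs => rw [← μ.toSignedMeasure_toJordanDecomposition]
    rw [JordanDecomposition.toSignedMeasure, Measure.toSignedMeasure_sub_apply hs]
  unfold sInt
  set p := μ.toJordanDecomposition.posPart
  set n := μ.toJordanDecomposition.negPart
  have hadd : p + Q = P + n := by
    refine Measure.ext_of_Iic _ _ fun t => ?_
    rw [← ENNReal.toReal_eq_toReal_iff' (measure_ne_top _ _) (measure_ne_top _ _)]
    change (p + Q).real _ = (P + n).real _
    rw [measureReal_add_apply, measureReal_add_apply, real_Iic_eq hp, real_Iic_eq hn,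
      real_Iic_eq hP, real_Iic_eq hQ]
    rcases lt_or_ge t 0 with ht | ht
    · rw [Set.Icc_eq_empty (by
        rw [not_le]; exact lt_of_le_of_lt (min_le_left _ _) ht)]
      simp
    · have hm : min t T ∈ Set.Icc 0 T := ⟨le_min ht hT, min_le_right _ _⟩
      have h1 := hPQ _ hm
      have h2 := hμ.1 _ hm
      rw [hμs _ measurableSet_Icc] at h2
      linarith
  have hfint := congrArg (fun ν : Measure ℝ => ∫ t, f t ∂ν) hadd
  beta_reduce at hfint
  rw [integral_add_measure (hf.integrable hp) (hf.integrable hQ),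
    integral_add_measure (hf.integrable hP) (hf.integrable hn)] at hfint
  linarith

theorem intD_eq {T : ℝ} (hT : 0 ≤ T) {A f : ℝ → ℝ}
    {P Q : Measure ℝ} [IsFiniteMeasure P] [IsFiniteMeasure Q]
    (hP : P (Set.Icc 0 T)ᶜ = 0) (hQ : Q (Set.Icc 0 T)ᶜ = 0)
    (hPQ : ∀ t ∈ Set.Icc (0:ℝ) T, P.real (Set.Icc 0 t) - Q.real (Set.Icc 0 t) = A t)
    (hf : BddMeasurableOn T f) : intD T f A = ∫ t, f t ∂P - ∫ t, f t ∂Q := by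
  have hex : ∃ μ : SignedMeasure ℝ, Represents T μ A := by
    refine ⟨P.toSignedMeasure - Q.toSignedMeasure, fun t ht => ?_, fun s hs hd => ?_⟩
    · rw [Measure.toSignedMeasure_sub_apply measurableSet_Icc, hPQ t ht]
    · have hsub : s ⊆ (Set.Icc 0 T)ᶜ := fun r hr hr' => by
        have : r ∈ s ∩ Set.Icc 0 T := ⟨hr, hr'⟩
        rw [hd] at this; exact this
      rw [Measure.toSignedMeasure_sub_apply hs, measureReal_def, measureReal_def,
        measure_mono_null hsub hP, measure_mono_null hsub hQ]
      simp
  unfold intD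
  rw [dif_pos hex]
  exact sInt_eq_of_represents hT hex.choose_spec hP hQ hPQ hf

theorem intD_zero {T : ℝ} (hT : 0 ≤ T) {f : ℝ → ℝ} (hf : BddMeasurableOn T f) :
    intD T f 0 = 0 := by
  rw [intD_eq hT (P := 0) (Q := 0) (by simp) (by simp) (by simp) hf]
  simp

/-- The Stieltjes function of a function constant on `(-∞,0]` with value `0` and on `[T,∞)`. -/
theorem stieltjes_facts {T : ℝ} (F : StieltjesFunction ℝ) (h0 : ∀ t ≤ 0, F t = 0)
    (h1 : ∀ t, T ≤ t → F t = F T) :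
    IsFiniteMeasure F.measure ∧ F.measure (Set.Icc 0 T)ᶜ = 0 ∧ F.measure.real Set.univ = F T ∧
      ∀ t, 0 ≤ t → F.measure.real (Set.Icc 0 t) = F t := by
  have hbot : Tendsto F atBot (𝓝 0) :=
    tendsto_const_nhds.congr' ((eventually_le_atBot 0).mono fun t ht => (h0 t ht).symm)
  have htop : Tendsto F atTop (𝓝 (F T)) :=
    tendsto_const_nhds.congr' ((eventually_ge_atTop T).mono fun t ht => (h1 t ht).symm)
  have hl : Function.leftLim F 0 = 0 := by
    apply leftLim_eq_of_tendsto
    exact tendsto_const_nhds.congr'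
        (eventually_nhdsWithin_of_forall fun t (ht : t < 0) => (h0 t ht.le).symm)
  have hnn : ∀ t, 0 ≤ F t := fun t => by
    rcases le_total t 0 with h | h
    · exact (h0 t h).ge
    · rw [← h0 0 le_rfl]; exact F.mono h
  refine ⟨F.isFiniteMeasure hbot htop, ?_, ?_, ?_⟩
  · have : (Set.Icc 0 T)ᶜ ⊆ Set.Iio 0 ∪ Set.Ioi T := by
      intro t ht
      simp only [Set.mem_compl_iff, Set.mem_Icc, not_and_or, not_le] at ht
      exact ht
    refine measure_mono_null this (measure_union_null ?_ ?_)
    · rw [F.measure_Iio hbot, hl]; simp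
    · rw [F.measure_Ioi htop]; simp
  · rw [measureReal_def, F.measure_univ hbot htop, sub_zero, ENNReal.toReal_ofReal (hnn _)]
  · intro t _
    rw [measureReal_def, F.measure_Icc, hl, sub_zero, ENNReal.toReal_ofReal (hnn _)]

theorem MemA.exists_measures {T : ℝ} (hT : 0 < T) {A : ℝ → ℝ} (hA : MemA T A) :
    ∃ P Q : Measure ℝ, IsFiniteMeasure P ∧ IsFiniteMeasure Q ∧
      P (Set.Icc 0 T)ᶜ = 0 ∧ Q (Set.Icc 0 T)ᶜ = 0 ∧
      (∀ t ∈ Set.Icc (0:ℝ) T, P.real (Set.Icc 0 t) - Q.real (Set.Icc 0 t) = A t) ∧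
      (∀ a b : ℝ, 0 ≤ a → a ≤ b →
        P.real (Set.Ico a b) - Q.real (Set.Ico a b) = A (min b T) - A (min a T)) ∧
      P.real Set.univ + Q.real Set.univ ≤ 3 * (eVariationOn A (Set.Icc 0 T)).toReal := by
  obtain ⟨hc, hbv, hA0⟩ := hA
  let g : ℝ → ℝ := fun t => max 0 (min t T)
  have hgm : Monotone g := fun a b hab => max_le_max le_rfl (min_le_min hab le_rfl)
  have hgc : Continuous g := by fun_prop
  have hgI : ∀ t, g t ∈ Set.Icc 0 T := fun t => ⟨le_max_left _ _, max_le hT.le (min_le_right _ _)⟩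
  have hvar : eVariationOn (A ∘ g) Set.univ ≤ eVariationOn A (Set.Icc 0 T) :=
    eVariationOn.comp_le_of_monotoneOn A g (hgm.monotoneOn _) fun t _ => hgI t
  have hB : BoundedVariationOn (A ∘ g) Set.univ := ne_top_of_le_ne_top hbv hvar
  have hBc : Continuous (A ∘ g) := hc.comp_continuous hgc hgI
  set B := A ∘ g with hBdef
  have hloc := hB.locallyBoundedVariationOn
  set V : ℝ → ℝ := variationOnFromTo B Set.univ 0 with hV
  have hB0 : ∀ t ≤ 0, B t = 0 := fun t ht => by
    simp [B, g, min_eq_left (ht.trans hT.le), ht, hA0]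
  have hB1 : ∀ t, T ≤ t → B t = B T := fun t ht => by simp [B, g, ht]
  have hBt : ∀ t, 0 ≤ t → B t = A (min t T) := fun t ht => by
    simp only [B, g, Function.comp]
    rw [max_eq_right (le_min ht hT.le)]
  have hV0 : ∀ t ≤ 0, V t = 0 := fun t ht => by
    rw [hV, variationOnFromTo.eq_zero_iff_of_ge hloc (mem_univ _) (mem_univ _) ht]
    intro r hr q hq
    rw [hB0 r hr.2.2, hB0 q hq.2.2, edist_self]
  have hV1 : ∀ t, T ≤ t → V t = V T := fun t ht => by
    rw [hV, variationOnFromTo.eq_left_iff hloc (mem_univ _) (mem_univ _) (mem_univ _),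
      variationOnFromTo.eq_zero_iff_of_ge hloc (mem_univ _) (mem_univ _) ht]
    intro r hr q hq
    rw [hB1 r hr.2.1, hB1 q hq.2.1, edist_self]
  let F : StieltjesFunction ℝ :=
    { toFun := V
      mono' := monotoneOn_univ.1 (variationOnFromTo.monotoneOn hloc (mem_univ _))
      right_continuous' := fun x =>
        hB.continuousWithinAt_variationOnFromTo_Ici hBc.continuousWithinAt }
  let G : StieltjesFunction ℝ :=
    { toFun := V - B
      mono' := monotoneOn_univ.1 (variationOnFromTo.sub_self_monotoneOn hloc (mem_univ _))
      right_continuous' := fun x =>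
        (hB.continuousWithinAt_variationOnFromTo_Ici hBc.continuousWithinAt).sub
          hBc.continuousWithinAt }
  have hFG : ∀ t, G t = F t - B t := fun t => rfl
  obtain ⟨f1, f2, f3, f4⟩ := stieltjes_facts (T := T) F hV0 hV1
  obtain ⟨g1, g2, g3, g4⟩ := stieltjes_facts (T := T) G
    (fun t ht => by rw [hFG, hB0 t ht, sub_zero]; exact hV0 t ht)
    (fun t ht => by rw [hFG, hFG, hB1 t ht]; congr 1; exact hV1 t ht)
  have hlim : ∀ t, Function.leftLim G t = Function.leftLim F t - B t := fun t => by
    have h1 := G.mono.tendsto_leftLim t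
    have h2 := (F.mono.tendsto_leftLim t).sub (hBc.continuousWithinAt (s := Set.Iio t) (x := t))
    exact tendsto_nhds_unique h1 h2
  refine ⟨F.measure, G.measure, f1, g1, f2, g2, fun t ht => ?_, fun a b ha hab => ?_, ?_⟩
  · rw [f4 t ht.1, g4 t ht.1, hFG, hBt t ht.1, min_eq_left ht.2]; ring
  · rw [measureReal_def, measureReal_def, F.measure_Ico, G.measure_Ico,
      ENNReal.toReal_ofReal (sub_nonneg.2 (F.mono.leftLim hab)),
      ENNReal.toReal_ofReal (sub_nonneg.2 (G.mono.leftLim hab)), hlim, hlim,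
      hBt a ha, hBt b (ha.trans hab)]
    ring
  · rw [f3, g3, hFG]
    have h1 : F T ≤ (eVariationOn B Set.univ).toReal :=
      (le_abs_self _).trans (variationOnFromTo.abs_le_eVariationOn hB)
    have h2 : B 0 - B T ≤ (eVariationOn B Set.univ).toReal := hB.sub_le (mem_univ _) (mem_univ _)
    have h3 : (eVariationOn B Set.univ).toReal ≤ (eVariationOn A (Set.Icc 0 T)).toReal :=
      ENNReal.toReal_mono hbv hvar
    have h4 := hB0 0 le_rfl
    linarith

theorem abs_intD_sub_le {T : ℝ} (hT : 0 < T) {A f g : ℝ → ℝ} (hA : MemA T A)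
    (hf : BddMeasurableOn T f) (hg : BddMeasurableOn T g) {ε : ℝ} (hε : 0 ≤ ε)
    (hfg : ∀ t ∈ Set.Icc (0:ℝ) T, |f t - g t| ≤ ε) :
    |intD T f A - intD T g A| ≤ ε * (3 * (eVariationOn A (Set.Icc 0 T)).toReal) := by
  obtain ⟨P, Q, iP, iQ, hP, hQ, hPQ, -, hV⟩ := hA.exists_measures hT
  rw [intD_eq hT.le hP hQ hPQ hf, intD_eq hT.le hP hQ hPQ hg]
  have key : ∀ ν : Measure ℝ, IsFiniteMeasure ν → ν (Set.Icc 0 T)ᶜ = 0 →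
      |∫ t, f t ∂ν - ∫ t, g t ∂ν| ≤ ε * ν.real Set.univ := fun ν _ hν => by
    rw [← integral_sub (hf.integrable hν) (hg.integrable hν), ← Real.norm_eq_abs]
    refine norm_integral_le_of_norm_le_const ?_
    have : ∀ᵐ r ∂ν, r ∈ Set.Icc 0 T := by rw [ae_iff]; exact hν
    filter_upwards [this] with r hr using hfg r hr
  have h1 := abs_le.1 (key P iP hP)
  have h2 := abs_le.1 (key Q iQ hQ)
  have h3 := mul_le_mul_of_nonneg_left hV hε
  rw [abs_le]
  constructor <;> linarith

theorem exists_tendsto_of_approx {α : Type*} {f : α → ℝ} {l : Filter α} [l.NeBot]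
    (h : ∀ ε > 0, ∃ c, ∀ᶠ r in l, |f r - c| ≤ ε) : ∃ L, Tendsto f l (𝓝 L) := by
  have hc : Cauchy (Filter.map f l) := by
    rw [Metric.cauchy_iff]
    refine ⟨inferInstance, fun ε hε => ?_⟩
    obtain ⟨c, hc⟩ := h (ε / 3) (by positivity)
    refine ⟨f '' {r | |f r - c| ≤ ε / 3}, Filter.image_mem_map hc, ?_⟩
    rintro _ ⟨r, hr, rfl⟩ _ ⟨q, hq, rfl⟩
    have hr := abs_le.1 (show |f r - c| ≤ ε / 3 from hr)
    have hq := abs_le.1 (show |f q - c| ≤ ε / 3 from hq)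
    rw [Real.dist_eq, abs_lt]
    constructor <;> linarith
  obtain ⟨L, hL⟩ := CompleteSpace.complete hc
  exact ⟨L, hL⟩

theorem CadlagInf.exists_bound {x : ℝ → ℝ} (hx : CadlagInf x) (T : ℝ) :
    ∃ M : ℝ, ∀ t ∈ Set.Icc (0:ℝ) T, |x t| ≤ M := by
  refine isCompact_Icc.induction_on (p := fun s => ∃ M : ℝ, ∀ t ∈ s, |x t| ≤ M)
    ⟨0, by simp⟩ ?_ ?_ ?_
  · rintro s t hst ⟨M, hM⟩
    exact ⟨M, fun r hr => hM r (hst hr)⟩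
  · rintro s t ⟨M, hM⟩ ⟨M', hM'⟩
    refine ⟨max M M', ?_⟩
    rintro r (hr | hr)
    · exact (hM r hr).trans (le_max_left _ _)
    · exact (hM' r hr).trans (le_max_right _ _)
  · intro t ht
    have hb : ∀ {l : Filter ℝ} {L : ℝ}, Tendsto x l (𝓝 L) → ∀ᶠ r in l, |x r| ≤ |L| + 1 :=
      fun h => (h.abs.eventually (eventually_lt_nhds (lt_add_one _))).mono fun _ h => h.le
    have hR := hb (hx.1 t ht.1)
    have hL : ∃ M : ℝ, ∀ᶠ r in 𝓝[<] t, r ∈ Set.Icc 0 T → |x r| ≤ M := by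
      rcases ht.1.eq_or_lt with h | h
      · refine ⟨0, eventually_nhdsWithin_of_forall fun r (hr : r < t) hr' => ?_⟩
        exact absurd hr (by rw [not_lt, ← h]; exact hr'.1)
      · obtain ⟨L, hL⟩ := hx.2 t h
        exact ⟨_, (hb hL).mono fun _ h _ => h⟩
    obtain ⟨M, hM⟩ := hL
    refine ⟨{r | r ∈ Set.Icc 0 T → |x r| ≤ max M (|x t| + 1)} ∩ Set.Icc 0 T, ?_, _,
      fun r hr => hr.1 hr.2⟩
    refine Filter.inter_mem ?_ self_mem_nhdsWithin
    refine mem_nhdsWithin_of_mem_nhds ?_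
    rw [← nhdsLT_sup_nhdsGE, Filter.mem_sup, ← Set.Ioi_insert, nhdsWithin_insert, Filter.mem_sup]
    refine ⟨hM.mono fun r h hr => (h hr).trans (le_max_left _ _), ?_,
      hR.mono fun r h _ => h.trans (le_max_right _ _)⟩
    exact fun _ => (lt_add_one _).le.trans (le_max_right _ _)

theorem CadlagInf.measurable_indicator {x : ℝ → ℝ} (hx : CadlagInf x) :
    Measurable ((Set.Ici (0:ℝ)).indicator x) := by
  refine measurable_of_tendsto_metrizable
    (f := fun (n : ℕ) => (Set.Ici (0:ℝ)).indicator
      fun t => x (((⌊((n:ℝ) + 1) * t⌋ : ℝ) + 1) / ((n:ℝ) + 1))) (fun n => ?_) ?_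
  · refine Measurable.indicator ?_ measurableSet_Ici
    exact (measurable_from_top (f := fun z : ℤ => x (((z : ℝ) + 1) / ((n:ℝ) + 1)))).comp
      (Int.measurable_floor.comp (measurable_const.mul measurable_id))
  · rw [tendsto_pi_nhds]
    intro t
    by_cases ht : t ∈ Set.Ici (0:ℝ)
    · simp only [Set.indicator_of_mem ht]
      refine (hx.1 t ht).comp (tendsto_nhdsWithin_iff.2 ⟨?_, Filter.Eventually.of_forall fun n => ?_⟩)
      · have hlim : Tendsto (fun n : ℕ => t + 1 / ((n:ℝ) + 1)) atTop (𝓝 t) := by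
          simpa using tendsto_const_nhds.add (tendsto_one_div_add_atTop_nhds_zero_nat (𝕜 := ℝ))
        refine tendsto_of_tendsto_of_tendsto_of_le_of_le tendsto_const_nhds hlim
          (fun n => ?_) (fun n => ?_)
        · have := Int.lt_floor_add_one (((n:ℝ) + 1) * t)
          rw [le_div_iff₀ (by positivity)]
          linarith
        · have := Int.floor_le (((n:ℝ) + 1) * t)
          have hn : (0:ℝ) < (n:ℝ) + 1 := by positivity
          change _ / _ ≤ t + 1 / ((n:ℝ) + 1)
          rw [div_le_iff₀ hn, add_mul t, one_div_mul_cancel hn.ne']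
          linarith
      · have := Int.lt_floor_add_one (((n:ℝ) + 1) * t)
        change t < _
        rw [lt_div_iff₀ (by positivity)]
        linarith
    · simp only [Set.indicator_of_notMem ht]
      exact tendsto_const_nhds

theorem CadlagInf.bddMeasurableOn {x : ℝ → ℝ} (hx : CadlagInf x) (T : ℝ) :
    BddMeasurableOn T x := by
  refine ⟨?_, hx.exists_bound T⟩
  have : (Set.Icc 0 T).indicator x = (Set.Icc 0 T).indicator ((Set.Ici (0:ℝ)).indicator x) := by
    rw [Set.indicator_indicator, Set.inter_eq_left.2 Set.Icc_subset_Ici_self]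
  rw [this]
  exact hx.measurable_indicator.indicator measurableSet_Icc

/-- The step function with value `c k` on `[τ k, τ (k+1))` for `k < N`, and `0` elsewhere. -/
def stepFun (N : ℕ) (τ c : ℕ → ℝ) (t : ℝ) : ℝ :=
  ∑ k ∈ Finset.range N, (Set.Ico (τ k) (τ (k + 1))).indicator (fun _ => c k) t

theorem stepFun_eq {N : ℕ} {τ c : ℕ → ℝ} (hτ : Monotone τ) {k : ℕ} (hk : k < N) {t : ℝ}
    (ht : t ∈ Set.Ico (τ k) (τ (k + 1))) : stepFun N τ c t = c k := by
  unfold stepFun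
  rw [Finset.sum_eq_single k]
  · exact Set.indicator_of_mem ht _
  · intro j _ hj
    refine Set.indicator_of_notMem (fun h => ?_) _
    rcases lt_or_gt_of_ne hj with h' | h'
    · exact absurd (h.2.trans_le (hτ (Nat.succ_le_of_lt h'))) (not_lt.2 ht.1)
    · exact absurd (ht.2.trans_le (hτ (Nat.succ_le_of_lt h'))) (not_lt.2 h.1)
  · intro h; exact absurd (Finset.mem_range.2 hk) h

theorem exists_mem_Ico {N : ℕ} {τ : ℕ → ℝ} {t : ℝ} (h0 : τ 0 ≤ t) (hN : t < τ N) :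
    ∃ k < N, t ∈ Set.Ico (τ k) (τ (k + 1)) := by
  induction N with
  | zero => exact absurd hN (not_lt.2 h0)
  | succ N ih =>
    rcases lt_or_ge t (τ N) with h | h
    · obtain ⟨k, hk, hk'⟩ := ih h
      exact ⟨k, by omega, hk'⟩
    · exact ⟨N, by omega, h, hN⟩

theorem measurable_stepFun (N : ℕ) (τ c : ℕ → ℝ) : Measurable (stepFun N τ c) :=
  Finset.measurable_sum _ fun _ _ => measurable_const.indicator measurableSet_Ico

theorem bddMeasurableOn_stepFun (T : ℝ) (N : ℕ) (τ c : ℕ → ℝ) :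
    BddMeasurableOn T (stepFun N τ c) := by
  refine ⟨(measurable_stepFun N τ c).indicator measurableSet_Icc,
    ∑ k ∈ Finset.range N, |c k|, fun t _ => ?_⟩
  refine (Finset.abs_sum_le_sum_abs _ _).trans (Finset.sum_le_sum fun k _ => ?_)
  by_cases h : t ∈ Set.Ico (τ k) (τ (k + 1))
  · rw [Set.indicator_of_mem h]
  · rw [Set.indicator_of_notMem h]; simp

theorem intD_stepFun {T : ℝ} (hT : 0 < T) {A : ℝ → ℝ} (hA : MemA T A) (N : ℕ) {τ c : ℕ → ℝ}
    (hτ : Monotone τ) (h0 : 0 ≤ τ 0) :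
    intD T (stepFun N τ c) A =
      ∑ k ∈ Finset.range N, c k * (A (min (τ (k + 1)) T) - A (min (τ k) T)) := by
  obtain ⟨P, Q, iP, iQ, hP, hQ, hPQ, hI, -⟩ := hA.exists_measures hT
  rw [intD_eq hT.le hP hQ hPQ (bddMeasurableOn_stepFun T N τ c)]
  have key : ∀ ν : Measure ℝ, IsFiniteMeasure ν → ∫ t, stepFun N τ c t ∂ν =
      ∑ k ∈ Finset.range N, c k * ν.real (Set.Ico (τ k) (τ (k + 1))) := fun ν _ => by
    unfold stepFun
    rw [integral_finsetSum _ fun k _ => (integrable_const _).indicator measurableSet_Ico]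
    refine Finset.sum_congr rfl fun k _ => ?_
    rw [integral_indicator measurableSet_Ico, setIntegral_const, smul_eq_mul, mul_comm]
  rw [key P iP, key Q iQ, ← Finset.sum_sub_distrib]
  refine Finset.sum_congr rfl fun k _ => ?_
  rw [← mul_sub, hI _ _ (h0.trans (hτ (Nat.zero_le k))) (hτ (Nat.le_succ k))]

theorem tendsto_stepFun {N : ℕ} {τ : ℕ → ℕ → ℝ} {c : ℕ → ℕ → ℝ} {τ₀ c₀ : ℕ → ℝ}
    (hτ : ∀ k, Tendsto (fun n => τ n k) atTop (𝓝 (τ₀ k)))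
    (hc : ∀ k, Tendsto (fun n => c n k) atTop (𝓝 (c₀ k))) {t : ℝ} (ht : ∀ k ≤ N, t ≠ τ₀ k) :
    Tendsto (fun n => stepFun N (τ n) (c n) t) atTop (𝓝 (stepFun N τ₀ c₀ t)) := by
  have hev : ∀ k ≤ N, ∀ᶠ n in atTop, (τ n k ≤ t ↔ τ₀ k ≤ t) := fun k hk => by
    rcases lt_or_gt_of_ne (ht k hk) with h | h
    · filter_upwards [(hτ k).eventually (lt_mem_nhds h)] with n hn
      simp only [not_le.2 hn, not_le.2 h]
    · filter_upwards [(hτ k).eventually (gt_mem_nhds h)] with n hn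
      simp only [hn.le, h.le]
  refine tendsto_finsetSum _ fun k hk => ?_
  have hk := Finset.mem_range.1 hk
  have hmem : ∀ᶠ n in atTop,
      (t ∈ Set.Ico (τ n k) (τ n (k + 1)) ↔ t ∈ Set.Ico (τ₀ k) (τ₀ (k + 1))) := by
    filter_upwards [hev k hk.le, hev (k + 1) hk] with n h1 h2
    simp only [Set.mem_Ico, ← not_le, h1, h2]
  by_cases h : t ∈ Set.Ico (τ₀ k) (τ₀ (k + 1))
  · rw [Set.indicator_of_mem h]
    refine (hc k).congr' ?_
    filter_upwards [hmem] with n hn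
    rw [Set.indicator_of_mem (hn.2 h)]
  · rw [Set.indicator_of_notMem h]
    refine tendsto_const_nhds.congr' ?_
    filter_upwards [hmem] with n hn
    rw [Set.indicator_of_notMem (mt hn.1 h)]

theorem stepFun_eventuallyEq_right (N : ℕ) (τ c : ℕ → ℝ) (t : ℝ) :
    ∀ᶠ r in 𝓝[>] t, stepFun N τ c r = stepFun N τ c t := by
  have hev : ∀ k, ∀ᶠ r in 𝓝[>] t, (τ k ≤ r ↔ τ k ≤ t) := fun k => by
    rcases le_or_gt (τ k) t with h | h
    · filter_upwards [self_mem_nhdsWithin] with r hr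
      simp only [h, h.trans (le_of_lt hr)]
    · filter_upwards [mem_nhdsWithin_of_mem_nhds (gt_mem_nhds h)] with r hr
      simp only [not_le.2 h, not_le.2 hr]
  have hall : ∀ᶠ r in 𝓝[>] t, ∀ k ∈ Finset.range (N + 1), (τ k ≤ r ↔ τ k ≤ t) :=
    (Filter.eventually_all_finset _).2 fun k _ => hev k
  filter_upwards [hall] with r hr
  refine Finset.sum_congr rfl fun k hk => ?_
  have hk := Finset.mem_range.1 hk
  have h1 := hr k (Finset.mem_range.2 (by omega))
  have h2 := hr (k + 1) (Finset.mem_range.2 (by omega))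
  simp only [Set.indicator_apply, Set.mem_Ico, ← not_le, h1, h2]

theorem stepFun_eventually_const_left (N : ℕ) (τ c : ℕ → ℝ) (t : ℝ) :
    ∃ d, ∀ᶠ r in 𝓝[<] t, stepFun N τ c r = d := by
  classical
  have hev : ∀ k, ∀ᶠ r in 𝓝[<] t, (τ k ≤ r ↔ τ k < t) := fun k => by
    rcases lt_or_ge (τ k) t with h | h
    · filter_upwards [mem_nhdsWithin_of_mem_nhds (lt_mem_nhds h)] with r hr
      simp only [h, le_of_lt hr]
    · filter_upwards [self_mem_nhdsWithin] with r hr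
      simp only [not_lt.2 h, not_le.2 (lt_of_lt_of_le hr h)]
  have hall : ∀ᶠ r in 𝓝[<] t, ∀ k ∈ Finset.range (N + 1), (τ k ≤ r ↔ τ k < t) :=
    (Filter.eventually_all_finset _).2 fun k _ => hev k
  refine ⟨∑ k ∈ Finset.range N, if τ k < t ∧ ¬ τ (k + 1) < t then c k else 0, ?_⟩
  filter_upwards [hall] with r hr
  refine Finset.sum_congr rfl fun k hk => ?_
  have hk := Finset.mem_range.1 hk
  have h1 := hr k (Finset.mem_range.2 (by omega))
  have h2 := hr (k + 1) (Finset.mem_range.2 (by omega))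
  simp only [Set.indicator_apply, Set.mem_Ico, ← not_le (a := τ (k + 1)), h1, h2]

/-- Greedy decomposition: if `x` has at most `N` `η/2`-oscillations after time `s`, it is within
`η` of a step function with `N + 1` steps. -/
theorem exists_step_times {x : ℝ → ℝ} (hx : CadlagInf x) {T η : ℝ} (hη : 0 < η) (N : ℕ) :
    ∀ s : ℝ, 0 ≤ s → s ≤ T →
      (¬ ∃ p q : Fin (N + 1) → ℝ, (∀ i, s ≤ p i ∧ p i < q i ∧ q i ≤ T) ∧
        (∀ i j : Fin (N + 1), i < j → q i ≤ p j) ∧ (∀ i, |x (q i) - x (p i)| > η / 2)) →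
      ∃ τ : ℕ → ℝ, Monotone τ ∧ τ 0 = s ∧ (∀ k, N < k → τ k = T) ∧
        ∀ k ≤ N, ∀ t ∈ Set.Ico (τ k) (τ (k + 1)), |x t - x (τ k)| ≤ η := by
  have hnext : ∀ s : ℝ, 0 ≤ s → s ≤ T → (∀ t ∈ Set.Ico s T, |x t - x s| ≤ η) ∨
      ∃ u, s < u ∧ u ≤ T ∧ (∀ t ∈ Set.Ico s u, |x t - x s| ≤ η) ∧ η / 2 < |x u - x s| := by
    intro s hs hsT
    by_cases hall : ∀ t ∈ Set.Ico s T, |x t - x s| ≤ η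
    · exact Or.inl hall
    right
    push Not at hall
    obtain ⟨t₁, ht₁, hxt₁⟩ := hall
    set E : Set ℝ := {t | s ≤ t ∧ η < |x t - x s|} with hE
    have hne : E.Nonempty := ⟨t₁, ht₁.1, hxt₁⟩
    have hbdd : BddBelow E := ⟨s, fun t ht => ht.1⟩
    have hle : s ≤ sInf E := le_csInf hne fun t ht => ht.1
    have hbefore : ∀ t ∈ Set.Ico s (sInf E), |x t - x s| ≤ η := fun t ht => by
      by_contra h
      exact absurd (csInf_le hbdd ⟨ht.1, not_le.1 h⟩) (not_le.2 ht.2)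
    have hat : η / 2 < |x (sInf E) - x s| := by
      by_contra hcon
      push Not at hcon
      have hlt : |x (sInf E) - x s| < η := by linarith
      have hev := ((hx.1 (sInf E) (hs.trans hle)).sub_const (x s)).abs.eventually
        (gt_mem_nhds hlt)
      obtain ⟨b, hb, hb'⟩ := mem_nhdsGT_iff_exists_Ioo_subset.1 hev
      obtain ⟨e, he, heb⟩ := exists_lt_of_csInf_lt hne (show sInf E < b from hb)
      rcases (csInf_le hbdd he).eq_or_lt with h | h
      · rw [h] at hlt; exact absurd he.2 (not_lt.2 hlt.le)
      · exact absurd he.2 (not_lt.2 (le_of_lt (hb' ⟨h, heb⟩)))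
    refine ⟨sInf E, hle.lt_of_ne fun h => ?_, (csInf_le hbdd ⟨ht₁.1, hxt₁⟩).trans ht₁.2.le,
      hbefore, hat⟩
    rw [← h] at hat
    simp at hat
    linarith
  induction N with
  | zero =>
    intro s hs hsT hno
    rcases hnext s hs hsT with h | ⟨u, hsu, huT, -, hu⟩
    · refine ⟨fun k => if k = 0 then s else T, ?_, by simp, fun k hk => by simp [hk.ne'], ?_⟩
      · refine monotone_nat_of_le_succ fun k => ?_
        rcases k with _ | k <;> simp [hsT]
      · intro k hk t ht
        obtain rfl : k = 0 := by omega
        simpa using h t (by simpa using ht)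
    · refine absurd ⟨fun _ => s, fun _ => u, fun _ => ⟨le_rfl, hsu, huT⟩, fun i j hij => ?_,
        fun _ => hu⟩ hno
      exact absurd hij (by rw [Fin.lt_def]; omega)
  | succ N ih =>
    intro s hs hsT hno
    rcases hnext s hs hsT with h | ⟨u, hsu, huT, hbef, hu⟩
    · refine ⟨fun k => if k = 0 then s else T, ?_, by simp, fun k hk => by
        have : k ≠ 0 := by omega
        simp [this], ?_⟩
      · refine monotone_nat_of_le_succ fun k => ?_
        rcases k with _ | k <;> simp [hsT]
      · intro k hk t ht
        rcases k with _ | k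
        · simpa using h t (by simpa using ht)
        · exact absurd (ht.1.trans_lt ht.2) (by simp)
    · obtain ⟨τ, hτ, hτ0, hτT, hτx⟩ := ih u (hs.trans hsu.le) huT (by
        rintro ⟨p, q, h1, h2, h3⟩
        refine hno ⟨Fin.cons s p, Fin.cons u q, fun i => ?_, fun i j hij => ?_, fun i => ?_⟩
        · refine Fin.cases ?_ (fun i => ?_) i
          · exact ⟨le_rfl, hsu, huT⟩
          · exact ⟨hsu.le.trans (h1 i).1, (h1 i).2⟩
        · revert hij
          refine Fin.cases ?_ (fun j => ?_) j
          · intro h; exact absurd h (Fin.not_lt_zero _)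
          · refine Fin.cases ?_ (fun i => ?_) i
            · intro _; exact (h1 j).1
            · intro h; exact h2 i j (Fin.succ_lt_succ_iff.1 h)
        · refine Fin.cases ?_ (fun i => ?_) i
          · exact hu
          · exact h3 i)
      refine ⟨fun k => Nat.casesOn k s τ, ?_, rfl, fun k hk => ?_, fun k hk t ht => ?_⟩
      · refine monotone_nat_of_le_succ fun k => ?_
        rcases k with _ | k
        · change s ≤ τ 0; rw [hτ0]; exact hsu.le
        · exact hτ (Nat.le_succ k)
      · rcases k with _ | k
        · omega
        · exact hτT k (by omega)
      · rcases k with _ | k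
        · change t ∈ Set.Ico s (τ 0) at ht
          rw [hτ0] at ht
          exact hbef t ht
        · exact hτx k (by omega) t ht

theorem exists_subseq_step_approx {x : ℕ → ℝ → ℝ} (hx : ∀ n, CadlagInf (x n))
    (hM : ∀ T > 0, ∃ M : ℝ, ∀ n, ∀ t ∈ Set.Icc (0:ℝ) T, |x n t| ≤ M)
    (hN : ∀ T > 0, ∀ η > 0, ∃ N : ℕ, ∀ n k, HasOscillations T η (x n) k → k ≤ N) :
    ∃ φ : ℕ → ℕ, StrictMono φ ∧ ∃ (N : ℕ → ℕ) (τ c : ℕ → ℕ → ℕ → ℝ) (σ d : ℕ → ℕ → ℝ),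
      (∀ m n, Monotone (τ m n)) ∧ (∀ m n, τ m n 0 = 0) ∧
      (∀ m k, Tendsto (fun n => τ m n k) atTop (𝓝 (σ m k))) ∧
      (∀ m k, Tendsto (fun n => c m n k) atTop (𝓝 (d m k))) ∧
      ∀ (m n : ℕ) (t : ℝ), 0 ≤ t → t < (m:ℝ) + 1 →
        |x (φ n) t - stepFun (N m) (τ m n) (c m n) t| ≤ 1 / ((m:ℝ) + 1) := by
  have hpos : ∀ m : ℕ, (0:ℝ) < (m:ℝ) + 1 := fun m => by positivity
  choose M hM using fun m : ℕ => hM ((m:ℝ) + 1) (hpos m)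
  choose N hN using fun m : ℕ => hN ((m:ℝ) + 1) (hpos m) (1 / ((m:ℝ) + 1) / 2)
    (by have := hpos m; positivity)
  have hτ : ∀ m n : ℕ, ∃ τ : ℕ → ℝ, Monotone τ ∧ τ 0 = 0 ∧ (∀ k, N m < k → τ k = (m:ℝ) + 1) ∧
      ∀ k ≤ N m, ∀ t ∈ Set.Ico (τ k) (τ (k + 1)), |x n t - x n (τ k)| ≤ 1 / ((m:ℝ) + 1) :=
    fun m n => exists_step_times (hx n) (by have := hpos m; positivity) (N m) 0 le_rfl
      (hpos m).le fun h => absurd (hN m n _ h) (by omega)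
  choose τ hτm hτ0 hτT hτx using hτ
  have hmem : ∀ m n k : ℕ, τ m n k ∈ Set.Icc (0:ℝ) ((m:ℝ) + 1) := fun m n k =>
    ⟨(hτ0 m n).symm.le.trans (hτm m n (Nat.zero_le k)),
      (hτm m n (Nat.le_add_right k (N m + 1))).trans (hτT m n _ (by omega)).le⟩
  have hcomp : IsCompact (Set.pi Set.univ fun p : ℕ × ℕ =>
      Set.Icc (0:ℝ) ((p.1:ℝ) + 1) ×ˢ Set.Icc (-M p.1) (M p.1)) :=
    isCompact_univ_pi fun p => isCompact_Icc.prod isCompact_Icc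
  obtain ⟨z, -, φ, hφ, hz⟩ := hcomp.tendsto_subseq
    (x := fun n (p : ℕ × ℕ) => (τ p.1 n p.2, x n (τ p.1 n p.2)))
    fun n p _ => ⟨hmem p.1 n p.2, abs_le.1 (hM p.1 n _ (hmem p.1 n p.2))⟩
  have hz' := fun p => (tendsto_pi_nhds.1 hz) p
  refine ⟨φ, hφ, fun m => N m + 1, fun m n => τ m (φ n), fun m n k => x (φ n) (τ m (φ n) k),
    fun m k => (z (m, k)).1, fun m k => (z (m, k)).2, fun m n => hτm m _, fun m n => hτ0 m _,
    fun m k => (continuous_fst.tendsto _).comp (hz' (m, k)),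
    fun m k => (continuous_snd.tendsto _).comp (hz' (m, k)), fun m n t ht htm => ?_⟩
  obtain ⟨k, hk, hkt⟩ := exists_mem_Ico (N := N m + 1) (τ := τ m (φ n)) (t := t)
    (by rwa [hτ0]) (by rwa [hτT _ _ _ (Nat.lt_succ_self _)])
  rw [stepFun_eq (hτm m _) hk hkt]
  exact hτx m _ k (by omega) t hkt

theorem abs_stepFun_sub_le {y : ℕ → ℝ → ℝ} {N N' : ℕ} {τ c τ' c' : ℕ → ℕ → ℝ}
    {σ d σ' d' : ℕ → ℝ} {ε ε' T : ℝ}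
    (hτ : ∀ k, Tendsto (fun n => τ n k) atTop (𝓝 (σ k)))
    (hc : ∀ k, Tendsto (fun n => c n k) atTop (𝓝 (d k)))
    (hτ' : ∀ k, Tendsto (fun n => τ' n k) atTop (𝓝 (σ' k)))
    (hc' : ∀ k, Tendsto (fun n => c' n k) atTop (𝓝 (d' k)))
    (hy : ∀ n t, 0 ≤ t → t < T → |y n t - stepFun N (τ n) (c n) t| ≤ ε)
    (hy' : ∀ n t, 0 ≤ t → t < T → |y n t - stepFun N' (τ' n) (c' n) t| ≤ ε')
    {t : ℝ} (ht : 0 ≤ t) (htT : t < T) :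
    |stepFun N σ d t - stepFun N' σ' d' t| ≤ ε + ε' := by
  have hne : ∀ s : ℝ, ∀ᶠ r in 𝓝[>] t, r ≠ s := fun s => by
    rcases le_or_gt s t with h | h
    · filter_upwards [self_mem_nhdsWithin] with r hr
      exact (lt_of_le_of_lt h hr).ne'
    · filter_upwards [mem_nhdsWithin_of_mem_nhds (gt_mem_nhds h)] with r hr
      exact ne_of_lt hr
  have h1 : ∀ᶠ r in 𝓝[>] t, ∀ k ∈ Finset.range (N + 1), r ≠ σ k :=
    (Filter.eventually_all_finset _).2 fun k _ => hne _
  have h2 : ∀ᶠ r in 𝓝[>] t, ∀ k ∈ Finset.range (N' + 1), r ≠ σ' k :=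
    (Filter.eventually_all_finset _).2 fun k _ => hne _
  have hT : ∀ᶠ r in 𝓝[>] t, r < T := mem_nhdsWithin_of_mem_nhds (gt_mem_nhds htT)
  have hgt : ∀ᶠ r in 𝓝[>] t, t < r := self_mem_nhdsWithin
  obtain ⟨r, h1, h2, h3, h4, h5, h6⟩ := (h1.and (h2.and
    ((stepFun_eventuallyEq_right N σ d t).and ((stepFun_eventuallyEq_right N' σ' d' t).and
    (hT.and hgt))))).exists
  rw [← h3, ← h4]
  have hr : 0 ≤ r := ht.trans h6.le
  refine le_of_tendsto ((tendsto_stepFun hτ hc fun k hk => h1 k (by simpa using by omega)).sub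
    (tendsto_stepFun hτ' hc' fun k hk => h2 k (by simpa using by omega))).abs
    (Filter.Eventually.of_forall fun n => ?_)
  have a := abs_le.1 (hy n r hr h5)
  have b := abs_le.1 (hy' n r hr h5)
  rw [abs_le]
  constructor <;> linarith

theorem exists_cadlag_of_step_approx {N : ℕ → ℕ} {σ d : ℕ → ℕ → ℝ}
    (h : ∀ m l : ℕ, ∀ t : ℝ, 0 ≤ t → t < (m:ℝ) + 1 → t < (l:ℝ) + 1 →
      |stepFun (N m) (σ m) (d m) t - stepFun (N l) (σ l) (d l) t| ≤
        1 / ((m:ℝ) + 1) + 1 / ((l:ℝ) + 1)) :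
    ∃ x₀ : ℝ → ℝ, CadlagInf x₀ ∧ ∀ m : ℕ, ∀ t : ℝ, 0 ≤ t → t < (m:ℝ) + 1 →
      |x₀ t - stepFun (N m) (σ m) (d m) t| ≤ 1 / ((m:ℝ) + 1) := by
  have hlim : Tendsto (fun n : ℕ => 1 / ((n:ℝ) + 1)) atTop (𝓝 0) :=
    tendsto_one_div_add_atTop_nhds_zero_nat
  have hsmall : ∀ ε > 0, ∀ᶠ m : ℕ in atTop, 1 / ((m:ℝ) + 1) ≤ ε := fun ε hε =>
    (hlim.eventually (gt_mem_nhds hε)).mono fun _ h => le_of_lt h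
  have hlarge : ∀ t : ℝ, ∀ᶠ m : ℕ in atTop, t < (m:ℝ) + 1 := fun t => by
    filter_upwards [tendsto_natCast_atTop_atTop.eventually (eventually_ge_atTop t)] with m hm
    linarith
  have hex : ∀ t : ℝ, ∃ L : ℝ, 0 ≤ t → ∀ m : ℕ, t < (m:ℝ) + 1 →
      |L - stepFun (N m) (σ m) (d m) t| ≤ 1 / ((m:ℝ) + 1) := fun t => by
    by_cases ht : 0 ≤ t
    · obtain ⟨L, hL⟩ := exists_tendsto_of_approx (l := atTop)
        (f := fun m => stepFun (N m) (σ m) (d m) t) fun ε hε => by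
          obtain ⟨m, hm, hm'⟩ := ((hsmall (ε / 2) (by positivity)).and (hlarge t)).exists
          refine ⟨stepFun (N m) (σ m) (d m) t, ?_⟩
          filter_upwards [hsmall (ε / 2) (by positivity), hlarge t] with l hl hl'
          exact (h l m t ht hl' hm').trans (by linarith)
      refine ⟨L, fun _ m hm => ?_⟩
      refine le_of_tendsto_of_tendsto (hL.sub_const _).abs
        (by simpa only [zero_add] using hlim.add_const (1 / ((m:ℝ) + 1))) ?_
      filter_upwards [hlarge t] with l hl
      exact h l m t ht hl hm
    · exact ⟨0, fun h => absurd h ht⟩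
  choose x₀ hx₀ using hex
  refine ⟨x₀, ⟨fun t ht => ?_, fun t ht => ?_⟩, fun m t ht htm => hx₀ t ht m htm⟩
  · rw [Metric.tendsto_nhds]
    intro ε hε
    obtain ⟨m, hm, hm'⟩ := ((hsmall (ε / 3) (by positivity)).and (hlarge t)).exists
    filter_upwards [stepFun_eventuallyEq_right (N m) (σ m) (d m) t,
      mem_nhdsWithin_of_mem_nhds (gt_mem_nhds hm'), self_mem_nhdsWithin] with r hr hrm htr
    have a := abs_le.1 (hx₀ r (ht.trans (le_of_lt htr)) m hrm)
    have b := abs_le.1 (hx₀ t ht m hm')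
    rw [hr] at a
    rw [Real.dist_eq, abs_lt]
    constructor <;> linarith
  · refine exists_tendsto_of_approx fun ε hε => ?_
    obtain ⟨m, hm, hm'⟩ := ((hsmall ε hε).and (hlarge t)).exists
    obtain ⟨e, he⟩ := stepFun_eventually_const_left (N m) (σ m) (d m) t
    refine ⟨e, ?_⟩
    filter_upwards [he, mem_nhdsWithin_of_mem_nhds (lt_mem_nhds ht), self_mem_nhdsWithin]
      with r hr hr0 hrt
    rw [← hr]
    exact (hx₀ r (le_of_lt hr0) m (lt_trans hrt hm')).trans hm

theorem tendsto_intD_stepFun {T : ℝ} (hT : 0 < T) {A : ℕ → ℝ → ℝ} {A₀ : ℝ → ℝ}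
    (hA : ∀ n, MemA T (A n)) (hA₀ : MemA T A₀) (hAA : TauConv T A A₀) (N : ℕ)
    {τ c : ℕ → ℕ → ℝ} {σ d : ℕ → ℝ} (hτm : ∀ n, Monotone (τ n)) (hτ0 : ∀ n, τ n 0 = 0)
    (hτ : ∀ k, Tendsto (fun n => τ n k) atTop (𝓝 (σ k)))
    (hc : ∀ k, Tendsto (fun n => c n k) atTop (𝓝 (d k))) :
    Tendsto (fun n => intD T (stepFun N (τ n) (c n)) (A n)) atTop
      (𝓝 (intD T (stepFun N σ d) A₀)) := by
  have hσm : Monotone σ := fun i j hij =>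
    le_of_tendsto_of_tendsto' (hτ i) (hτ j) fun n => hτm n hij
  have hσ0 : 0 ≤ σ 0 := ge_of_tendsto' (hτ 0) fun n => (hτ0 n).ge
  rw [intD_stepFun hT hA₀ N hσm hσ0]
  simp only [fun n => intD_stepFun hT (hA n) N (c := c n) (hτm n) (hτ0 n).ge]
  have hval : ∀ k, Tendsto (fun n => A n (min (τ n k) T)) atTop (𝓝 (A₀ (min (σ k) T))) := by
    intro k
    have hmem : min (σ k) T ∈ Set.Icc 0 T :=
      ⟨le_min (hσ0.trans (hσm (Nat.zero_le k))) hT.le, min_le_right _ _⟩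
    refine hAA.1.tendsto_comp (hA₀.1 _ hmem) (tendsto_nhdsWithin_iff.2
      ⟨(hτ k).min tendsto_const_nhds, Filter.Eventually.of_forall fun n =>
        ⟨le_min ((hτ0 n).ge.trans (hτm n (Nat.zero_le k))) hT.le, min_le_right _ _⟩⟩)
  exact tendsto_finsetSum _ fun k _ => (hc k).mul ((hval (k + 1)).sub (hval k))

theorem exists_sStarConvInf_subseq {x : ℕ → ℝ → ℝ} (hx : ∀ n, CadlagInf (x n))
    (hM : ∀ T > 0, ∃ M : ℝ, ∀ n, ∀ t ∈ Set.Icc (0:ℝ) T, |x n t| ≤ M)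
    (hN : ∀ T > 0, ∀ η > 0, ∃ N : ℕ, ∀ n k, HasOscillations T η (x n) k → k ≤ N) :
    ∃ φ : ℕ → ℕ, StrictMono φ ∧ ∃ x₀ : ℝ → ℝ, CadlagInf x₀ ∧
      SStarConvInf (fun k => x (φ k)) x₀ := by
  obtain ⟨φ, hφ, N, τ, c, σ, d, hτm, hτ0, hτ, hc, hxs⟩ := exists_subseq_step_approx hx hM hN
  obtain ⟨x₀, hx₀, happ⟩ := exists_cadlag_of_step_approx (N := N) (σ := σ) (d := d)
    fun m l t ht htm htl => abs_stepFun_sub_le (y := fun n => x (φ n)) (T := min ((m:ℝ) + 1) (l + 1))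
      (hτ m) (hc m) (hτ l) (hc l)
      (fun n t ht htm => hxs m n t ht (htm.trans_le (min_le_left _ _)))
      (fun n t ht htm => hxs l n t ht (htm.trans_le (min_le_right _ _))) ht (lt_min htm htl)
  refine ⟨φ, hφ, x₀, hx₀, fun T hT A A₀ hA hA₀ hAA => ?_⟩
  obtain ⟨V, hV⟩ := hAA.2
  have hVn : ∀ n, (eVariationOn (A n) (Set.Icc 0 T)).toReal ≤ |V| := fun n =>
    ENNReal.toReal_le_of_le_ofReal (abs_nonneg V)
      ((hV n).trans (ENNReal.ofReal_le_ofReal (le_abs_self V)))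
  set W := 3 * (|V| + (eVariationOn A₀ (Set.Icc 0 T)).toReal) + 1 with hW
  have hv0 : 0 ≤ (eVariationOn A₀ (Set.Icc 0 T)).toReal := ENNReal.toReal_nonneg
  have hWpos : 0 < W := by positivity
  rw [Metric.tendsto_nhds]
  intro ε hε
  have hm : ∀ᶠ m : ℕ in atTop, 1 / ((m:ℝ) + 1) < ε / (3 * W) ∧ T < (m:ℝ) + 1 := by
    refine (tendsto_one_div_add_atTop_nhds_zero_nat.eventually
      (gt_mem_nhds (by positivity))).and ?_
    filter_upwards [tendsto_natCast_atTop_atTop.eventually (eventually_ge_atTop T)] with m hm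
    linarith
  obtain ⟨m, hm, hTm⟩ := hm.exists
  have hm0 : (0:ℝ) ≤ 1 / ((m:ℝ) + 1) := by positivity
  have hsmall : ∀ v : ℝ, v ≤ W → 1 / ((m:ℝ) + 1) * v ≤ ε / 3 := fun v hv => by
    refine (mul_le_mul_of_nonneg_left hv hm0).trans
      ((mul_le_mul_of_nonneg_right hm.le hWpos.le).trans (le_of_eq ?_))
    field_simp
  have h0 := (abs_intD_sub_le hT hA₀ (hx₀.bddMeasurableOn T)
    (bddMeasurableOn_stepFun T (N m) (σ m) (d m)) hm0
    fun t ht => happ m t ht.1 (ht.2.trans_lt hTm)).trans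
      (hsmall _ (by rw [hW]; have := abs_nonneg V; linarith))
  filter_upwards [Metric.tendsto_nhds.1 (tendsto_intD_stepFun hT hA hA₀ hAA (N m) (hτm m) (hτ0 m)
    (hτ m) (hc m)) (ε / 3) (by positivity)] with n hn
  have h1 := (abs_intD_sub_le hT (hA n) ((hx (φ n)).bddMeasurableOn T)
    (bddMeasurableOn_stepFun T (N m) (τ m n) (c m n)) hm0
    fun t ht => hxs m n t ht.1 (ht.2.trans_lt hTm)).trans
      (hsmall _ (by rw [hW]; have := hVn n; linarith))
  rw [Real.dist_eq] at hn ⊢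
  have h0 := abs_le.1 h0
  have h1 := abs_le.1 h1
  have hn := abs_lt.1 hn
  rw [abs_lt]
  constructor <;> linarith

/-- The continuous function rising linearly from `0` at `s` to `1` at `s + δ`. -/
def ramp (s δ t : ℝ) : ℝ := max 0 (min 1 ((t - s) / δ))

/-- The uniform probability measure on `(s, s + δ]`, whose distribution function is `ramp s δ`. -/
def rampMeasure (s δ : ℝ) : Measure ℝ :=
  ENNReal.ofReal δ⁻¹ • volume.restrict (Set.Ioc s (s + δ))

theorem continuous_ramp (s δ : ℝ) : Continuous (ramp s δ) := by
  unfold ramp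
  fun_prop

theorem ramp_nonneg (s δ t : ℝ) : 0 ≤ ramp s δ t := le_max_left _ _

theorem ramp_le_one (s δ t : ℝ) : ramp s δ t ≤ 1 := max_le zero_le_one (min_le_left _ _)

theorem monotone_ramp (s : ℝ) {δ : ℝ} (hδ : 0 < δ) : Monotone (ramp s δ) := fun t u h => by
  unfold ramp
  gcongr

theorem antitone_ramp {δ : ℝ} (hδ : 0 < δ) (t : ℝ) : Antitone fun s => ramp s δ t := fun s u h => by
  change max 0 (min 1 ((t - u) / δ)) ≤ max 0 (min 1 ((t - s) / δ))
  gcongr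

theorem monotone_sum_ramp {ι : Type*} [Fintype ι] (w : NNReal) (p : ι → ℝ) {δ : ℝ}
    (hδ : 0 < δ) : Monotone fun t => (w:ℝ) * ∑ i, ramp (p i) δ t := fun _ _ h =>
  mul_le_mul_of_nonneg_left (Finset.sum_le_sum fun i _ => monotone_ramp (p i) hδ h) w.coe_nonneg

theorem sum_ramp_le {ι : Type*} [Fintype ι] (p : ι → ℝ) (δ t : ℝ) :
    ∑ i, ramp (p i) δ t ≤ Fintype.card ι :=
  (Finset.sum_le_sum fun i _ => ramp_le_one (p i) δ t).trans (by simp)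

theorem ramp_zero {s δ : ℝ} (hs : 0 ≤ s) (hδ : 0 < δ) : ramp s δ 0 = 0 := by
  refine max_eq_left ((min_le_right _ _).trans ?_)
  exact div_nonpos_of_nonpos_of_nonneg (by linarith) hδ.le

instance (s δ : ℝ) : IsFiniteMeasure (rampMeasure s δ) := by
  unfold rampMeasure
  exact Measure.smul_finite _ ENNReal.ofReal_ne_top

theorem rampMeasure_real_univ (s : ℝ) {δ : ℝ} (hδ : 0 < δ) :
    (rampMeasure s δ).real Set.univ = 1 := by
  unfold rampMeasure
  rw [measureReal_ennreal_smul_apply, measureReal_restrict_apply MeasurableSet.univ,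
    Set.univ_inter, Real.volume_real_Ioc_of_le (by linarith),
    ENNReal.toReal_ofReal (inv_nonneg.2 hδ.le)]
  field_simp
  ring

theorem rampMeasure_null {s δ T : ℝ} (hs : 0 ≤ s) (hT : s + δ ≤ T) :
    rampMeasure s δ (Set.Icc 0 T)ᶜ = 0 := by
  unfold rampMeasure
  rw [Measure.smul_apply, Measure.restrict_apply measurableSet_Icc.compl]
  have : (Set.Icc 0 T)ᶜ ∩ Set.Ioc s (s + δ) = ∅ := by
    ext t
    simp only [mem_inter_iff, mem_compl_iff, Set.mem_Icc, Set.mem_Ioc, mem_empty_iff_false,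
      iff_false]
    rintro ⟨h, h1, h2⟩
    exact h ⟨by linarith, by linarith⟩
  simp [this]

theorem rampMeasure_real_Icc {s δ t : ℝ} (hs : 0 ≤ s) (hδ : 0 < δ) :
    (rampMeasure s δ).real (Set.Icc 0 t) = ramp s δ t := by
  unfold rampMeasure ramp
  have : Set.Icc 0 t ∩ Set.Ioc s (s + δ) = Set.Ioc s (min t (s + δ)) := by
    ext r
    simp only [mem_inter_iff, Set.mem_Icc, Set.mem_Ioc, le_min_iff]
    constructor
    · rintro ⟨⟨-, h⟩, h1, h2⟩
      exact ⟨h1, h, h2⟩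
    · rintro ⟨h1, h, h2⟩
      exact ⟨⟨by linarith, h⟩, h1, h2⟩
  rw [measureReal_ennreal_smul_apply, measureReal_restrict_apply measurableSet_Icc, this,
    Real.volume_real_Ioc, ENNReal.toReal_ofReal (inv_nonneg.2 hδ.le),
    mul_max_of_nonneg _ _ (inv_nonneg.2 hδ.le), mul_zero, max_comm, ← min_sub_sub_right,
    mul_min_of_nonneg _ _ (inv_nonneg.2 hδ.le), min_comm]
  congr 2
  · field_simp
    ring
  · field_simp

theorem abs_integral_rampMeasure_sub_le {s δ T ε : ℝ} (hs : 0 ≤ s) (hδ : 0 < δ)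
    (hT : s + δ ≤ T) {f : ℝ → ℝ} (hf : BddMeasurableOn T f)
    (hε : ∀ t ∈ Set.Icc s (s + δ), |f t - f s| ≤ ε) :
    |∫ t, f t ∂(rampMeasure s δ) - f s| ≤ ε := by
  have hfint := hf.integrable (rampMeasure_null hs hT)
  have h1 : ∫ t, f t ∂(rampMeasure s δ) - f s = ∫ t, (f t - f s) ∂(rampMeasure s δ) := by
    rw [integral_sub hfint (integrable_const _), integral_const, rampMeasure_real_univ s hδ,
      one_smul]
  have h2 : ∀ᵐ t ∂(rampMeasure s δ), ‖f t - f s‖ ≤ ε :=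
    Measure.ae_smul_measure (ae_restrict_of_forall_mem measurableSet_Ioc
      fun t ht => hε t ⟨ht.1.le, ht.2⟩) _
  have := norm_integral_le_of_norm_le_const h2
  rwa [rampMeasure_real_univ s hδ, mul_one, ← h1] at this

/-- The measure `w • ∑ i, rampMeasure (p i) δ` and its basic properties. -/
theorem rampSum_facts {ι : Type*} [Fintype ι] {p : ι → ℝ} {δ T ε : ℝ} (w : NNReal) (hδ : 0 < δ)
    (hp : ∀ i, 0 ≤ p i ∧ p i + δ ≤ T) {f : ℝ → ℝ} (hf : BddMeasurableOn T f)
    (hε : ∀ i, ∀ t ∈ Set.Icc (p i) (p i + δ), |f t - f (p i)| ≤ ε) :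
    ∃ P : Measure ℝ, IsFiniteMeasure P ∧ P (Set.Icc 0 T)ᶜ = 0 ∧
      (∀ t, P.real (Set.Icc 0 t) = w * ∑ i, ramp (p i) δ t) ∧
      |∫ t, f t ∂P - w * ∑ i, f (p i)| ≤ ε * (w * Fintype.card ι) := by
  refine ⟨w • ∑ i, rampMeasure (p i) δ, inferInstance, ?_, fun t => ?_, ?_⟩
  · rw [Measure.smul_apply, Measure.finsetSum_apply,
      Finset.sum_eq_zero fun i _ => rampMeasure_null (hp i).1 (hp i).2, smul_zero]
  · rw [measureReal_nnreal_smul_apply, measureReal_def, Measure.finsetSum_apply,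
      ENNReal.toReal_sum fun i _ => measure_ne_top _ _]
    exact congrArg _ (Finset.sum_congr rfl fun i _ => rampMeasure_real_Icc (hp i).1 hδ)
  · rw [integral_smul_nnreal_measure, integral_finsetSum_measure fun i _ =>
      hf.integrable (rampMeasure_null (hp i).1 (hp i).2), NNReal.smul_def, smul_eq_mul, ← mul_sub,
      ← Finset.sum_sub_distrib, abs_mul, abs_of_nonneg w.coe_nonneg, mul_left_comm]
    refine mul_le_mul_of_nonneg_left ((Finset.abs_sum_le_sum_abs _ _).trans
      ((Finset.sum_le_sum fun i _ => abs_integral_rampMeasure_sub_le (hp i).1 hδ (hp i).2 hf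
        (hε i)).trans ?_)) w.coe_nonneg
    simp [mul_comm]

theorem eVariationOn_sub_le_of_monotone {F G : ℝ → ℝ} (hF : Monotone F) (hG : Monotone G)
    {T : ℝ} (hT : 0 ≤ T) : eVariationOn (fun t => F t - G t) (Set.Icc 0 T) ≤
      ENNReal.ofReal (F T + G T - (F 0 + G 0)) := by
  have heq := ((hF.add hG).monotoneOn (Set.Icc 0 T)).eVariationOn_eq
    (Set.left_mem_Icc.2 hT) (Set.right_mem_Icc.2 hT)
  rw [Set.inter_self] at heq
  refine le_trans (iSup_le fun r => ?_) heq.le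
  refine (Finset.sum_le_sum fun i _ => ?_).trans (eVariationOn.sum_le (n := r.1) r.2.2.1 r.2.2.2)
  have h1 := hF (r.2.2.1 (Nat.le_succ i))
  have h2 := hG (r.2.2.1 (Nat.le_succ i))
  rw [edist_dist, edist_dist, Real.dist_eq, Real.dist_eq]
  refine ENNReal.ofReal_le_ofReal (le_trans (abs_le.2 ⟨?_, ?_⟩) (le_abs_self _)) <;>
    simp only [Nat.succ_eq_add_one] at * <;> linarith

/-- A test function approximating a weighted difference of point evaluations of `f`. -/
theorem exists_test_function {ι κ : Type*} [Fintype ι] [Fintype κ] {p : ι → ℝ} {q : κ → ℝ}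
    {T ε : ℝ} (hT : 0 < T) (hε : 0 < ε) (w : NNReal) (hp : ∀ i, 0 ≤ p i ∧ p i ≤ T)
    (hq : ∀ i, 0 ≤ q i ∧ q i ≤ T) {f : ℝ → ℝ} (hf : CadlagInf f) :
    ∃ δ > 0, ∃ A : ℝ → ℝ, (∀ t, A t = w * ∑ i, ramp (p i) δ t - w * ∑ j, ramp (q j) δ t) ∧
      MemA (T + 1) A ∧
      eVariationOn A (Set.Icc 0 (T + 1)) ≤
        ENNReal.ofReal (w * (Fintype.card ι + Fintype.card κ)) ∧
      |intD (T + 1) f A - (w * ∑ i, f (p i) - w * ∑ j, f (q j))| ≤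
        ε * (w * (Fintype.card ι + Fintype.card κ)) := by
  have hev : ∀ s, 0 ≤ s → ∀ᶠ δ in 𝓝[>] (0:ℝ), ∀ t ∈ Set.Icc s (s + δ), |f t - f s| ≤ ε := by
    intro s hs
    obtain ⟨b, hb, hb'⟩ := mem_nhdsGT_iff_exists_Ioo_subset.1
      (Metric.tendsto_nhds.1 (hf.1 s hs) ε hε)
    filter_upwards [mem_nhdsWithin_of_mem_nhds
      (gt_mem_nhds (sub_pos.2 (show s < b from hb)))] with δ hδ t ht
    rcases ht.1.eq_or_lt with h | h
    · simp [← h, hε.le]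
    · have := hb' ⟨h, by have := ht.2; have : δ < b - s := hδ; linarith⟩
      exact le_of_lt this
  have h1 : ∀ᶠ δ in 𝓝[>] (0:ℝ), δ < 1 := mem_nhdsWithin_of_mem_nhds (gt_mem_nhds zero_lt_one)
  have h0 : ∀ᶠ δ in 𝓝[>] (0:ℝ), 0 < δ := self_mem_nhdsWithin
  obtain ⟨δ, hδp, hδq, hδ1, hδ⟩ := ((eventually_all.2 fun i => hev (p i) (hp i).1).and
    ((eventually_all.2 fun j => hev (q j) (hq j).1).and (h1.and h0))).exists
  have hT1 : 0 < T + 1 := by linarith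
  have hbf := hf.bddMeasurableOn (T + 1)
  obtain ⟨P, iP, hP, hP1, hP2⟩ := rampSum_facts w hδ (T := T + 1)
    (fun i => ⟨(hp i).1, by linarith [(hp i).2]⟩) hbf hδp
  obtain ⟨Q, iQ, hQ, hQ1, hQ2⟩ := rampSum_facts w hδ (T := T + 1)
    (fun i => ⟨(hq i).1, by linarith [(hq i).2]⟩) hbf hδq
  have hvar : eVariationOn (fun t => (w:ℝ) * ∑ i, ramp (p i) δ t - w * ∑ j, ramp (q j) δ t)
      (Set.Icc 0 (T + 1)) ≤ ENNReal.ofReal (w * (Fintype.card ι + Fintype.card κ)) := by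
    refine (eVariationOn_sub_le_of_monotone (monotone_sum_ramp w p hδ) (monotone_sum_ramp w q hδ)
      hT1.le).trans (ENNReal.ofReal_le_ofReal ?_)
    simp only [fun i => ramp_zero (hp i).1 hδ, fun i => ramp_zero (hq i).1 hδ,
      Finset.sum_const_zero, mul_zero, add_zero, sub_zero]
    rw [← mul_add]
    exact mul_le_mul_of_nonneg_left (add_le_add (sum_ramp_le p δ _) (sum_ramp_le q δ _))
      w.coe_nonneg
  refine ⟨δ, hδ, _, fun t => rfl, ⟨?_, hvar.trans_lt ENNReal.ofReal_lt_top |>.ne, ?_⟩, hvar, ?_⟩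
  · refine Continuous.continuousOn ?_
    have := fun s => continuous_ramp s δ
    fun_prop
  · simp [fun i => ramp_zero (hp i).1 hδ, fun i => ramp_zero (hq i).1 hδ]
  · rw [intD_eq hT1.le hP hQ (fun t _ => by rw [hP1, hQ1]) hbf]
    have a := abs_le.1 hP2
    have b := abs_le.1 hQ2
    rw [abs_le]
    constructor <;> nlinarith

theorem SStarConvInf.tendsto_intD_zero {y : ℕ → ℝ → ℝ} {x₀ : ℝ → ℝ} (h : SStarConvInf y x₀)
    (hx₀ : CadlagInf x₀) {T : ℝ} (hT : 0 < T) {A : ℕ → ℝ → ℝ} (hA : ∀ n, MemA T (A n))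
    (hsup : ∀ n, ∀ t ∈ Set.Icc (0:ℝ) T, |A n t| ≤ 1 / ((n:ℝ) + 1)) {M : ℝ}
    (hV : ∀ n, eVariationOn (A n) (Set.Icc 0 T) ≤ ENNReal.ofReal M) :
    Tendsto (fun n => intD T (y n) (A n)) atTop (𝓝 0) := by
  have h0 : MemA T 0 := by
    refine ⟨continuousOn_const, ?_, rfl⟩
    have : eVariationOn (0 : ℝ → ℝ) (Set.Icc 0 T) = 0 :=
      eVariationOn.constant_on (Set.Subsingleton.anti (Set.subsingleton_singleton (a := (0:ℝ)))
        (by rintro _ ⟨t, -, rfl⟩; rfl))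
    rw [BoundedVariationOn, this]
    exact ENNReal.zero_ne_top
  rw [← intD_zero hT.le (hx₀.bddMeasurableOn T)]
  refine h T hT A 0 hA h0 ⟨?_, M, hV⟩
  rw [Metric.tendstoUniformlyOn_iff]
  intro ε hε
  filter_upwards [tendsto_one_div_add_atTop_nhds_zero_nat.eventually (gt_mem_nhds hε)]
    with n hn t ht
  rw [Pi.zero_apply, dist_zero_left]
  exact (hsup n t ht).trans_lt hn

theorem exists_bound_of_relatively_compact {K : Set (ℝ → ℝ)} (hK : ∀ x ∈ K, CadlagInf x)
    (h : ∀ x : ℕ → ℝ → ℝ, (∀ n, x n ∈ K) →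
      ∃ φ : ℕ → ℕ, StrictMono φ ∧ ∃ x₀ : ℝ → ℝ, CadlagInf x₀ ∧
        SStarConvInf (fun k => x (φ k)) x₀) {T : ℝ} (hT : 0 < T) :
    ∃ M : ℝ, ∀ x ∈ K, ∀ t ∈ Set.Icc (0:ℝ) T, |x t| ≤ M := by
  by_contra hcon
  push Not at hcon
  choose x hxK t ht hlt using fun n : ℕ => hcon ((n:ℝ) + 2)
  obtain ⟨φ, hφ, x₀, hx₀, hconv⟩ := h x hxK
  set w : ℕ → NNReal := fun n => 1 / ((n:NNReal) + 1) with hw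
  have hwr : ∀ n, (w n : ℝ) = 1 / ((n:ℝ) + 1) := fun n => by simp [hw]
  choose δ hδ A hAeq hA hAV hAI using fun n : ℕ => exists_test_function (ι := Unit) (κ := Empty)
    (p := fun _ => t (φ n)) (q := Empty.elim) hT one_pos (w n) (fun _ => ht (φ n))
    (fun i => i.elim) (hK _ (hxK (φ n)))
  have hlim := hconv.tendsto_intD_zero hx₀ (show 0 < T + 1 by linarith) hA (fun n s _ => by
    rw [hAeq]
    simp only [Finset.univ_unique, Finset.sum_const, Finset.card_singleton, one_smul,
      Finset.univ_eq_empty, Finset.sum_empty, mul_zero, sub_zero]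
    rw [abs_of_nonneg (mul_nonneg (w n).coe_nonneg (ramp_nonneg _ _ _)), ← hwr]
    exact mul_le_of_le_one_right (w n).coe_nonneg (ramp_le_one _ _ _)) (M := 1) (fun n => by
    refine (hAV n).trans (ENNReal.ofReal_le_ofReal ?_)
    rw [hwr, div_mul_eq_mul_div, div_le_one (by positivity)]
    simp)
  obtain ⟨n, hn⟩ := (Metric.tendsto_nhds.1 hlim 1 one_pos).exists
  rw [dist_zero_right, Real.norm_eq_abs] at hn
  have hI := hAI n
  simp only [Finset.univ_unique, Finset.sum_const, Finset.card_singleton, one_smul,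
    Finset.univ_eq_empty, Finset.sum_empty, mul_zero, sub_zero, Fintype.card_unit,
    Fintype.card_empty, Nat.cast_one, Nat.cast_zero, add_zero, mul_one, one_mul] at hI
  have hφn : (n:ℝ) ≤ φ n := by exact_mod_cast hφ.id_le n
  have hbig : 1 + (w n : ℝ) ≤ |(w n : ℝ) * x (φ n) (t (φ n))| := by
    rw [abs_mul, abs_of_nonneg (w n).coe_nonneg]
    calc 1 + (w n : ℝ) = w n * ((n:ℝ) + 2) := by rw [hwr]; field_simp; ring
      _ ≤ _ := mul_le_mul_of_nonneg_left (by linarith [hlt (φ n)]) (w n).coe_nonneg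
  have htri := abs_sub_abs_le_abs_sub ((w n : ℝ) * x (φ n) (t (φ n)))
    (intD (T + 1) (x (φ n)) (A n))
  rw [abs_sub_comm] at htri
  linarith

theorem sum_alternating_le {g : ℝ → ℝ} (hg : Antitone g) (hg1 : ∀ r, g r ≤ 1) (k : ℕ) :
    ∀ (s u : Fin k → ℝ) (B : ℝ), (∀ i, s i < u i) → (∀ i j, i < j → u i < s j) →
      (∀ i, u i ≤ B) → ∑ i, g (s i) - ∑ i, g (u i) ≤ 1 - g B := by
  induction k with
  | zero => intro s u B _ _ _; simpa using hg1 B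
  | succ k ih =>
    intro s u B h1 h2 h3
    rw [Fin.sum_univ_castSucc, Fin.sum_univ_castSucc]
    have := ih (fun i => s i.castSucc) (fun i => u i.castSucc) (s (Fin.last k))
      (fun i => h1 _) (fun i j hij => h2 _ _ (Fin.castSucc_lt_castSucc_iff.2 hij))
      (fun i => (h2 _ _ (Fin.castSucc_lt_last i)).le)
    have := hg (h3 (Fin.last k))
    linarith

theorem exists_upcrossing_bound_of_relatively_compact {K : Set (ℝ → ℝ)}
    (hK : ∀ x ∈ K, CadlagInf x)
    (h : ∀ x : ℕ → ℝ → ℝ, (∀ n, x n ∈ K) →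
      ∃ φ : ℕ → ℕ, StrictMono φ ∧ ∃ x₀ : ℝ → ℝ, CadlagInf x₀ ∧
        SStarConvInf (fun k => x (φ k)) x₀) {T a b : ℝ} (hT : 0 < T) (hab : a < b) :
    ∃ N : ℕ, ∀ x ∈ K, ∀ k : ℕ, HasUpcrossings T a b x k → k ≤ N := by
  by_contra hcon
  push Not at hcon
  choose x hxK k hk hlt using hcon
  obtain ⟨φ, hφ, x₀, hx₀, hconv⟩ := h x hxK
  choose s u hsu hord hcross using fun n => hk (φ n)
  have hkn : ∀ n : ℕ, (n:ℝ) + 1 ≤ k (φ n) := fun n => by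
    exact_mod_cast (Nat.succ_le_succ (hφ.id_le n)).trans (hlt (φ n))
  have hkpos : ∀ n : ℕ, (0:ℝ) < k (φ n) := fun n =>
    lt_of_lt_of_le (by positivity) (hkn n)
  set w : ℕ → NNReal := fun n => 1 / (k (φ n) : NNReal) with hw
  have hwr : ∀ n, (w n : ℝ) = 1 / (k (φ n) : ℝ) := fun n => by simp [hw]
  have hwk : ∀ n, (w n : ℝ) * (k (φ n) : ℝ) = 1 := fun n => by
    rw [hwr, one_div_mul_cancel (hkpos n).ne']
  choose δ hδ A hAeq hA hAV hAI using fun n : ℕ => exists_test_function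
    (p := u n) (q := s n) hT (show 0 < (b - a) / 4 by linarith) (w n)
    (fun i => ⟨((hsu n i).1.trans_lt (hsu n i).2.1).le, (hsu n i).2.2⟩)
    (fun i => ⟨(hsu n i).1, ((hsu n i).2.1.trans_le (hsu n i).2.2).le⟩) (hK _ (hxK (φ n)))
  have hlim := hconv.tendsto_intD_zero hx₀ (show 0 < T + 1 by linarith) hA (fun n t _ => by
    have hanti := antitone_ramp (hδ n) t
    have h1 := sum_alternating_le hanti (fun r => ramp_le_one r _ t) (k (φ n)) (s n) (u n) T
      (fun i => (hsu n i).2.1) (hord n) (fun i => (hsu n i).2.2)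
    have h2 : ∑ i, ramp (u n i) (δ n) t ≤ ∑ i, ramp (s n i) (δ n) t :=
      Finset.sum_le_sum fun i _ => hanti (hsu n i).2.1.le
    have h3 := ramp_nonneg T (δ n) t
    rw [hAeq, ← mul_sub, abs_mul, abs_of_nonneg (w n).coe_nonneg]
    refine (mul_le_of_le_one_right (w n).coe_nonneg (abs_le.2 ⟨?_, ?_⟩)).trans ?_
    · linarith
    · linarith
    · rw [hwr]
      exact one_div_le_one_div_of_le (by positivity) (hkn n)) (M := 2) (fun n => by
    refine (hAV n).trans (ENNReal.ofReal_le_ofReal ?_)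
    rw [Fintype.card_fin, mul_add, hwk]
    norm_num)
  obtain ⟨n, hn⟩ := (Metric.tendsto_nhds.1 hlim ((b - a) / 2) (by linarith)).exists
  rw [dist_zero_right, Real.norm_eq_abs] at hn
  have hI := hAI n
  rw [Fintype.card_fin, mul_add, hwk, ← mul_sub, ← Finset.sum_sub_distrib] at hI
  have hbig : b - a ≤ (w n : ℝ) * ∑ i, (x (φ n) (u n i) - x (φ n) (s n i)) := by
    calc b - a = (w n : ℝ) * ∑ _i : Fin (k (φ n)), (b - a) := by
          rw [Finset.sum_const, Finset.card_univ, Fintype.card_fin, nsmul_eq_mul, ← mul_assoc,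
            hwk, one_mul]
      _ ≤ _ := mul_le_mul_of_nonneg_left (Finset.sum_le_sum fun i _ => by
          linarith [(hcross n i).1, (hcross n i).2]) (w n).coe_nonneg
  have h1 := (abs_le.1 hI).1
  have h2 := (abs_lt.1 hn).2
  linarith

/-- Theorem 5.2: criterion of relative `S`-compactness in `D([0,∞))`. -/
theorem stmt12 (K : Set (ℝ → ℝ)) (hK : ∀ x ∈ K, CadlagInf x) :
    ((∀ x : ℕ → ℝ → ℝ, (∀ n, x n ∈ K) →
        ∃ φ : ℕ → ℕ, StrictMono φ ∧ ∃ x₀ : ℝ → ℝ, CadlagInf x₀ ∧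
          SStarConvInf (fun k => x (φ k)) x₀)
      ↔
      ((∀ T > (0:ℝ), ∃ M : ℝ, ∀ x ∈ K, ∀ t ∈ Set.Icc (0:ℝ) T, |x t| ≤ M) ∧
        (∀ T > (0:ℝ), ∀ a b : ℝ, a < b →
          ∃ N : ℕ, ∀ x ∈ K, ∀ k : ℕ, HasUpcrossings T a b x k → k ≤ N)))
    ∧
    (((∀ T > (0:ℝ), ∃ M : ℝ, ∀ x ∈ K, ∀ t ∈ Set.Icc (0:ℝ) T, |x t| ≤ M) ∧
        (∀ T > (0:ℝ), ∀ a b : ℝ, a < b →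
          ∃ N : ℕ, ∀ x ∈ K, ∀ k : ℕ, HasUpcrossings T a b x k → k ≤ N))
      ↔
      ((∀ T > (0:ℝ), ∃ M : ℝ, ∀ x ∈ K, ∀ t ∈ Set.Icc (0:ℝ) T, |x t| ≤ M) ∧
        (∀ T > (0:ℝ), ∀ η > (0:ℝ),
          ∃ N : ℕ, ∀ x ∈ K, ∀ k : ℕ, HasOscillations T η x k → k ≤ N))) := by
  have hosc : ((∀ T > (0:ℝ), ∃ M : ℝ, ∀ x ∈ K, ∀ t ∈ Set.Icc (0:ℝ) T, |x t| ≤ M) ∧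
        (∀ T > (0:ℝ), ∀ a b : ℝ, a < b →
          ∃ N : ℕ, ∀ x ∈ K, ∀ k : ℕ, HasUpcrossings T a b x k → k ≤ N)) →
      ∀ T > (0:ℝ), ∀ η > (0:ℝ),
        ∃ N : ℕ, ∀ x ∈ K, ∀ k : ℕ, HasOscillations T η x k → k ≤ N := by
    rintro ⟨hM, hN⟩ T hT η hη
    obtain ⟨M, hM⟩ := hM T hT
    exact exists_oscillation_bound hη hM (hN T hT)
  refine ⟨⟨fun h => ⟨fun T hT => exists_bound_of_relatively_compact hK h hT,
    fun T hT a b hab => exists_upcrossing_bound_of_relatively_compact hK h hT hab⟩, ?_⟩,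
    fun h => ⟨h.1, hosc h⟩, fun h => ⟨h.1, fun T hT a b hab => ?_⟩⟩
  · intro h x hx
    refine exists_sStarConvInf_subseq (fun n => hK _ (hx n)) (fun T hT => ?_) (fun T hT η hη => ?_)
    · obtain ⟨M, hM⟩ := h.1 T hT
      exact ⟨M, fun n => hM _ (hx n)⟩
    · obtain ⟨N, hN⟩ := hosc h T hT η hη
      exact ⟨N, fun n => hN _ (hx n)⟩
  · obtain ⟨N, hN⟩ := h.2 T hT (b - a) (sub_pos.2 hab)
    exact ⟨N, fun x hx k hk => hN x hx k hk.hasOscillations⟩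

end
end
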